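/- Every 1-planar graph with minimum degree 7 contains a triangle whose three vertices have degrees 7, 7, and at most 9. -/

import Mathlib

/-- A 1-planar drawing of a simple graph in the plane: vertices at distinct
points, each edge an injective continuous arc between the images of its
endpoints, arc interiors avoiding vertices, any two arcs crossing in at most
one interior point, and every edge crossing at most one other edge. -/
structure OnePlanarDrawing {V : Type*} (G : SimpleGraph V) where
  pos : V → ℝ × ℝ
  pos_inj : Function.Injective pos
  arc : G.edgeSet → ℝ → ℝ × ℝ
  arc_cont : ∀ e, ContinuousOn (arc e) (Set.Icc 0 1)
  arc_inj : ∀ e, Set.InjOn (arc e) (Set.Icc 0 1)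
  arc_ends : ∀ e : G.edgeSet, ∃ u v : V, (e : Sym2 V) = s(u, v) ∧
      arc e 0 = pos u ∧ arc e 1 = pos v
  arc_avoids : ∀ e, ∀ t ∈ Set.Ioo (0 : ℝ) 1, arc e t ∉ Set.range pos
  crossings_subsingleton : ∀ e f : G.edgeSet, e ≠ f →
      (arc e '' Set.Ioo 0 1 ∩ arc f '' Set.Ioo 0 1).Subsingleton
  at_most_one_crossing : ∀ e : G.edgeSet,
      {f : G.edgeSet | f ≠ e ∧
        (arc e '' Set.Ioo 0 1 ∩ arc f '' Set.Ioo 0 1).Nonempty}.Subsingleton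

/-- A graph is 1-planar if it admits a drawing in the plane in which every
edge crosses at most one other edge. -/
def SimpleGraph.IsOnePlanar {V : Type*} (G : SimpleGraph V) : Prop :=
  Nonempty (OnePlanarDrawing G)

namespace OnePlanar

open Equiv

section Permutations

variable {D : Type*}

theorem rel_of_sameCycle (r : Setoid D) {σ : Perm D} (h : ∀ x, r x (σ x)) {x y : D}
    (hxy : σ.SameCycle x y) : r x y := by
  obtain ⟨i, rfl⟩ := hxy
  have key : ∀ (n : ℕ) (x : D), r x ((σ ^ n) x) := by
    intro n
    induction n with
    | zero => exact fun x => r.refl x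
    | succ n ih =>
      intro x
      rw [pow_succ', Perm.mul_apply]
      exact r.trans (ih x) (h _)
  obtain ⟨n, rfl | rfl⟩ := i.eq_nat_or_neg
  · exact key n x
  · have := key n ((σ ^ (-(n : ℤ))) x)
    rw [zpow_neg, zpow_natCast, ← Perm.mul_apply, mul_inv_cancel, Perm.one_apply] at this
    rw [zpow_neg, zpow_natCast]
    exact r.symm this

theorem sameCycle_le {σ τ : Perm D} (h : ∀ x, τ.SameCycle x (σ x)) {x y : D}
    (hxy : σ.SameCycle x y) : τ.SameCycle x y :=
  rel_of_sameCycle (Perm.SameCycle.setoid τ) h hxy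

theorem sameCycle_self_apply (σ : Perm D) (x : D) : σ.SameCycle x (σ x) :=
  Perm.sameCycle_apply_right.2 (Perm.SameCycle.refl _ _)

/-- The permutation induced on a finite set of points by first return. -/
theorem exists_firstReturn {D' : Type*} [Finite D'] (σ : Perm D) (ι : D' → D)
    (hι : Function.Injective ι) (hper : ∀ x, ∃ n, 0 < n ∧ (σ ^ n) (ι x) = ι x) :
    ∃ τ : Perm D', (∀ x y, τ.SameCycle x y ↔ σ.SameCycle (ι x) (ι y)) ∧
      ∀ c z : D → ZMod 2, (∀ d, c (σ d) = c d + z d) → (∀ d, d ∉ Set.range ι → z d = 0) →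
        ∀ x, c (ι (τ x)) = c (ι x) + z (ι x) := by
  classical
  have hex : ∀ x, ∃ n, 0 < n ∧ (σ ^ n) (ι x) ∈ Set.range ι := fun x => by
    obtain ⟨n, hn, h⟩ := hper x
    exact ⟨n, hn, x, h.symm⟩
  let N : D' → ℕ := fun x => Nat.find (hex x)
  have hN : ∀ x, 0 < N x ∧ (σ ^ N x) (ι x) ∈ Set.range ι := fun x => Nat.find_spec (hex x)
  have hmin : ∀ x m, 0 < m → (σ ^ m) (ι x) ∈ Set.range ι → N x ≤ m :=
    fun x m h0 h => Nat.find_min' (hex x) ⟨h0, h⟩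
  choose t ht using fun x => (hN x).2
  have hinj : Function.Injective t := by
    have key : ∀ x y, N x ≤ N y → t x = t y → x = y := by
      intro x y hle hxy
      have h1 : (σ ^ N x) (ι x) = (σ ^ N y) (ι y) := by rw [← ht, ← ht, hxy]
      obtain ⟨k, hk⟩ := Nat.exists_eq_add_of_le hle
      rw [hk, pow_add, Perm.mul_apply] at h1
      have h2 : ι x = (σ ^ k) (ι y) := (σ ^ N x).injective h1
      rcases Nat.eq_zero_or_pos k with rfl | hk0
      · exact hι (by simpa using h2)
      · have := hmin y k hk0 ⟨x, h2⟩
        have := (hN x).1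
        omega
    intro x y hxy
    rcases le_total (N x) (N y) with h | h
    · exact key x y h hxy
    · exact (key y x h hxy.symm).symm
  let τ : Perm D' := Equiv.ofBijective t (Finite.injective_iff_bijective.1 hinj)
  have hτ : ∀ x, ι (τ x) = (σ ^ N x) (ι x) := fun x => ht x
  refine ⟨τ, fun x y => ⟨fun h => ?_, fun h => ?_⟩, fun c z hc hz x => ?_⟩
  · refine rel_of_sameCycle ((Perm.SameCycle.setoid σ).comap ι) (fun x => ?_) h
    change σ.SameCycle (ι x) (ι (τ x))
    rw [hτ]
    exact Perm.sameCycle_pow_right.2 (Perm.SameCycle.refl _ _)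
  · have hnat : ∃ n : ℕ, (σ ^ n) (ι x) = ι y := by
      obtain ⟨i, hi⟩ := h
      obtain ⟨n, rfl | rfl⟩ := i.eq_nat_or_neg
      · exact ⟨n, by simpa using hi⟩
      · obtain ⟨p, hp, hpx⟩ := hper x
        obtain ⟨q, rfl⟩ : ∃ q, p = q + 1 := ⟨p - 1, by omega⟩
        refine ⟨q * n, ?_⟩
        have hfix : ∀ m : ℕ, ((σ ^ (q + 1)) ^ m) (ι x) = ι x := by
          intro m
          induction m with
          | zero => rfl
          | succ m ih => rw [pow_succ, Perm.mul_apply, hpx, ih]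
        have h3 := hfix n
        rw [← pow_mul, add_mul, one_mul, add_comm, pow_add, Perm.mul_apply] at h3
        rw [← hi, zpow_neg, zpow_natCast, Perm.eq_inv_iff_eq]
        exact h3
    obtain ⟨n, hn⟩ := hnat
    induction n using Nat.strong_induction_on generalizing x with
    | _ n ih =>
      rcases Nat.eq_zero_or_pos n with rfl | h0
      · rw [hι (show ι x = ι y by simpa using hn)]
      · have hle := hmin x n h0 ⟨y, hn.symm⟩
        have h1 : (σ ^ (n - N x)) (ι (τ x)) = ι y := by
          rw [hτ, ← Perm.mul_apply, ← pow_add, Nat.sub_add_cancel hle, hn]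
        have h2 : σ.SameCycle (ι (τ x)) (ι y) := by
          rw [← h1]
          exact Perm.sameCycle_pow_right.2 (Perm.SameCycle.refl _ _)
        have := ih (n - N x) (by have := (hN x).1; omega) (τ x) h2 h1
        exact (sameCycle_self_apply τ x).trans this
  · have key : ∀ j, 0 < j → j ≤ N x → c ((σ ^ j) (ι x)) = c (ι x) + z (ι x) := by
      intro j h0
      induction j, h0 using Nat.le_induction with
      | base => intro _; simpa using hc (ι x)
      | succ j hj ih =>
        intro hle
        have hmem : (σ ^ j) (ι x) ∉ Set.range ι := fun hmem => by
          have := hmin x j hj hmem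
          omega
        rw [pow_succ', Perm.mul_apply, hc, ih (by omega), hz _ hmem, add_zero]
    rw [hτ]
    exact key _ (hN x).1 le_rfl

/-- Multiplying by a transposition of points in different cycles merges these cycles. -/
theorem sameCycle_mul_swap_iff [Finite D] [DecidableEq D] (σ : Perm D) {d b : D}
    (hdb : ¬ σ.SameCycle d b) (r : Setoid D) (hr : ∀ x y, r x y ↔ σ.SameCycle x y) (x y : D) :
    (σ * swap d b).SameCycle x y ↔
      Relation.EqvGen (fun x y => r x y ∨ (x = d ∧ y = b)) x y := by
  set τ := σ * swap d b with hτ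
  have hτd : τ d = σ b := by simp [hτ]
  have hτb : τ b = σ d := by simp [hτ]
  have hτo : ∀ x, x ≠ d → x ≠ b → τ x = σ x := fun x h1 h2 => by
    simp [hτ, swap_apply_of_ne_of_ne h1 h2]
  have hbd : τ.SameCycle b d := by
    have key : ∀ k : ℕ, τ.SameCycle b ((σ ^ (k + 1)) d) := by
      intro k
      induction k with
      | zero => simpa [hτb] using sameCycle_self_apply τ b
      | succ k ih =>
        rw [pow_succ', Perm.mul_apply]
        by_cases h : (σ ^ (k + 1)) d = d
        · rw [h, ← hτb]
          exact sameCycle_self_apply τ b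
        · rw [← hτo _ h]
          · exact ih.trans (sameCycle_self_apply τ _)
          · intro h'
            exact hdb ⟨((k + 1 : ℕ) : ℤ), by rw [zpow_natCast]; exact h'⟩
    have h0 : 0 < orderOf σ := orderOf_pos_iff.2 (isOfFinOrder_of_finite σ)
    have := key (orderOf σ - 1)
    rwa [Nat.sub_add_cancel h0, pow_orderOf_eq_one, Perm.one_apply] at this
  have hle : ∀ x, τ.SameCycle x (σ x) := by
    intro x
    by_cases h1 : x = d
    · rw [h1, ← hτb]
      exact hbd.symm.trans (sameCycle_self_apply τ b)
    by_cases h2 : x = b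
    · rw [h2, ← hτd]
      exact hbd.trans (sameCycle_self_apply τ d)
    rw [← hτo x h1 h2]
    exact sameCycle_self_apply τ x
  constructor
  · intro h
    refine rel_of_sameCycle (Relation.EqvGen.setoid _) (fun x => ?_) h
    change Relation.EqvGen _ x (τ x)
    have hdb' : Relation.EqvGen (fun x y => r x y ∨ (x = d ∧ y = b)) d b :=
      .rel _ _ (Or.inr ⟨rfl, rfl⟩)
    have hs : ∀ x, Relation.EqvGen (fun x y => r x y ∨ (x = d ∧ y = b)) x (σ x) := fun x =>
      .rel _ _ (Or.inl ((hr _ _).2 (sameCycle_self_apply σ x)))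
    by_cases h1 : x = d
    · rw [h1, hτd]
      exact .trans _ _ _ hdb' (hs b)
    by_cases h2 : x = b
    · rw [h2, hτb]
      exact .trans _ _ _ (.symm _ _ hdb') (hs d)
    rw [hτo x h1 h2]
    exact hs x
  · intro h
    induction h with
    | rel x y h =>
      rcases h with h | ⟨rfl, rfl⟩
      · exact sameCycle_le hle ((hr _ _).1 h)
      · exact hbd.symm
    | refl x => exact Perm.SameCycle.refl _ _
    | symm x y _ ih => exact ih.symm
    | trans x y z _ _ ih1 ih2 => exact ih1.trans ih2

end Permutations

section PlanarMaps

variable {D : Type*} [Fintype D]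

open scoped Classical in
/-- The sum of `z` over the cycle of `σ` through `x`. -/
noncomputable def cycleSum (σ : Perm D) (z : D → ZMod 2) (x : D) : ZMod 2 :=
  ∑ d with σ.SameCycle x d, z d

/-- Homological planarity of the map with vertex rotation `σ` and edge involution `α` from which
the edges of `T` have been deleted: every even set of edges is the boundary of a set of faces. -/
def MapPlanar (T : Set D) (σ : Perm D) (α : D → D) : Prop :=
  ∀ z : D → ZMod 2, (∀ d, z (α d) = z d) → (∀ d ∈ T, z d = 0) → (∀ x, cycleSum σ z x = 0) →
    ∃ c : D → ZMod 2, (∀ d, c (σ d) = c d + z d) ∧ ∀ d, c (α d) = c d + z d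

theorem MapPlanar.mono {T T' : Set D} (h : T ⊆ T') {σ : Perm D} {α : D → D}
    (hp : MapPlanar T σ α) : MapPlanar T' σ α :=
  fun z hz hT hs => hp z hz (fun d hd => hT d (h hd)) hs

theorem cycleSum_congr {σ : Perm D} {z : D → ZMod 2} {x y : D} (h : σ.SameCycle x y) :
    cycleSum σ z x = cycleSum σ z y := by
  unfold cycleSum
  congr 1
  ext d
  simp only [Finset.mem_filter, Finset.mem_univ, true_and]
  exact ⟨fun h' => h.symm.trans h', fun h' => h.trans h'⟩

theorem zmod_two_add_self (a : ZMod 2) : a + a = 0 := CharTwo.add_self_eq_zero a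

open scoped Classical in
theorem MapPlanar.contract {T : Set D} {σ : Perm D} {α : D → D} (hα : ∀ d, α (α d) = d)
    (hp : MapPlanar T σ α) {d : D} (hd : d ∉ T) (hd' : α d ∉ T)
    (hne : ¬ σ.SameCycle d (α d))
    (hσ' : ∀ x y, (σ * swap d (σ⁻¹ (α d))).SameCycle x y ↔
      σ.SameCycle x y ∨ (σ.SameCycle x d ∧ σ.SameCycle (α d) y) ∨
        (σ.SameCycle x (α d) ∧ σ.SameCycle d y)) :
    MapPlanar (insert d T) (σ * swap d (σ⁻¹ (α d))) α := by
  set b := σ⁻¹ (α d) with hb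
  have hσb : σ b = α d := by simp [hb]
  set τ := σ * swap d b with hτ
  intro z hz hT hs
  have hzd : z d = 0 := hT d (Set.mem_insert _ _)
  have hzd' : z (α d) = 0 := by rw [hz, hzd]
  have hdd : α d ≠ d := fun h => hne (by rw [h])
  set t := cycleSum σ z d with ht
  set w : D → ZMod 2 := fun x => z x + if x = d ∨ x = α d then t else 0 with hw
  have hsum : ∀ x, cycleSum σ w x = cycleSum σ z x +
      ((if σ.SameCycle x d then t else 0) + if σ.SameCycle x (α d) then t else 0) := by
    intro x
    unfold cycleSum
    rw [hw, Finset.sum_add_distrib]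
    congr 1
    have h1 : ∀ y, (if y = d ∨ y = α d then t else 0) =
        (if y = d then t else 0) + if y = α d then t else 0 := by
      intro y
      by_cases h1 : y = d
      · simp [h1, hdd.symm]
      · simp [h1]
    simp only [h1, Finset.sum_add_distrib, Finset.sum_filter]
    congr 1
    · rw [Finset.sum_eq_single d]
      · simp
      · intro y _ hy
        simp [hy]
      · simp
    · rw [Finset.sum_eq_single (α d)]
      · simp
      · intro y _ hy
        simp [hy]
      · simp
  have hmerge : cycleSum σ z d + cycleSum σ z (α d) = 0 := by
    rw [← hs d]
    unfold cycleSum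
    rw [← Finset.sum_union]
    · congr 1
      ext y
      simp only [Finset.mem_union, Finset.mem_filter, Finset.mem_univ, true_and]
      rw [hσ']
      constructor
      · rintro (h | h)
        · exact Or.inl h
        · exact Or.inr (Or.inl ⟨Perm.SameCycle.refl _ _, h⟩)
      · rintro (h | ⟨_, h⟩ | ⟨h, _⟩)
        · exact Or.inl h
        · exact Or.inr h
        · exact absurd h hne
    · rw [Finset.disjoint_filter]
      intro y _ h1 h2
      exact hne (h1.trans h2.symm)
  have hw0 : ∀ x, cycleSum σ w x = 0 := by
    intro x
    rw [hsum]
    by_cases h1 : σ.SameCycle x d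
    · have h2 : ¬ σ.SameCycle x (α d) := fun h => hne (h1.symm.trans h)
      rw [if_pos h1, if_neg h2, cycleSum_congr h1, add_zero]
      exact zmod_two_add_self _
    by_cases h2 : σ.SameCycle x (α d)
    · rw [if_neg h1, if_pos h2, cycleSum_congr h2, zero_add, add_comm]
      exact hmerge
    rw [if_neg h1, if_neg h2, add_zero, add_zero, ← hs x]
    unfold cycleSum
    congr 1
    ext y
    simp only [Finset.mem_filter, Finset.mem_univ, true_and]
    rw [hσ']
    simp [h1, h2]
  have hwT : ∀ x ∈ T, w x = 0 := by
    intro x hx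
    have h1 : x ≠ d := fun h => hd (h ▸ hx)
    have h2 : x ≠ α d := fun h => hd' (h ▸ hx)
    simp [hw, h1, h2, hT x (Set.mem_insert_of_mem _ hx)]
  have hwα : ∀ x, w (α x) = w x := by
    intro x
    have h1 : (α x = d ∨ α x = α d) ↔ (x = d ∨ x = α d) := by
      constructor
      · rintro (h | h)
        · right; rw [← h, hα]
        · left; rw [← hα x, h, hα]
      · rintro (h | h)
        · right; rw [h]
        · left; rw [h, hα]
    simp only [hw, hz, h1]
  obtain ⟨c, hc1, hc2⟩ := hp w hwα hwT hw0
  have hwo : ∀ x, x ≠ d → x ≠ α d → w x = z x := fun x h1 h2 => by simp [hw, h1, h2]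
  have hwd : w d = t := by simp [hw, hzd]
  have hwd' : w (α d) = t := by simp [hw, hzd']
  have hσd : c (σ d) = c (α d) := by rw [hc1, hc2]
  have hσα : c (σ (α d)) = c d := by
    rw [hc1, hc2, hwd, hwd', add_assoc, zmod_two_add_self, add_zero]
  have hτd : τ d = α d := by simp [hτ, hσb]
  have hτb : τ b = σ d := by simp [hτ]
  have hτo : ∀ x, x ≠ d → x ≠ b → τ x = σ x := fun x h1 h2 => by
    simp [hτ, swap_apply_of_ne_of_ne h1 h2]
  have hσinj : ∀ x, σ x = α d ↔ x = b := fun x => by rw [← hσb, σ.injective.eq_iff]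
  set c' : D → ZMod 2 := fun x => if x = α d then c d else c x with hc'
  have hbd : b ≠ d := fun h => hne (by rw [← hσb, h]; exact sameCycle_self_apply σ d)
  have hσd_ne : σ d ≠ α d := fun h => hbd ((hσinj d).1 h).symm
  refine ⟨c', fun x => ?_, fun x => ?_⟩
  · by_cases h1 : x = d
    · subst h1
      simp [hτd, hc', hzd]
    by_cases h2 : x = b
    · rw [h2, hτb]
      simp only [hc', if_neg hσd_ne, hσd]
      by_cases h3 : b = α d
      · rw [if_pos h3, h3, hzd', add_zero, ← hσα, ← h3, hσb, h3]
      · rw [if_neg h3, ← hσb, hc1, hwo b hbd h3]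
    rw [hτo x h1 h2]
    have h4 : σ x ≠ α d := fun h => h2 ((hσinj x).1 h)
    simp only [hc', if_neg h4]
    by_cases h3 : x = α d
    · rw [if_pos h3, h3, hσα, hzd', add_zero]
    · rw [if_neg h3, hc1, hwo x h1 h3]
  · by_cases h1 : x = d
    · simp [hc', h1, hzd]
    by_cases h2 : x = α d
    · simp [hc', h2, hα, hzd']
    have h3 : α x ≠ α d := fun h => h1 (by rw [← hα x, h, hα])
    simp only [hc', if_neg h2, if_neg h3]
    rw [hc2, hwo x h1 h2]

/-- Contracting a set of edges of a planar map. -/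
theorem MapPlanar.exists_contract {σ : Perm D} {α : D → D} (hα : ∀ d, α (α d) = d)
    (hp : MapPlanar ∅ σ α) (T : Finset D) :
    ∃ τ : Perm D, MapPlanar (T : Set D) τ α ∧ ∀ x y, τ.SameCycle x y ↔
      Relation.EqvGen (fun x y => σ.SameCycle x y ∨ (x ∈ T ∧ y = α x)) x y := by
  classical
  induction T using Finset.induction_on with
  | empty =>
    refine ⟨σ, by simpa using hp, fun x y => ⟨fun h => .rel _ _ (Or.inl h), fun h => ?_⟩⟩
    induction h with
    | rel x y h => simpa using h
    | refl x => exact Perm.SameCycle.refl _ _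
    | symm x y _ ih => exact ih.symm
    | trans x y z _ _ ih1 ih2 => exact ih1.trans ih2
  | insert d T hd ih =>
    obtain ⟨τ, hτp, hτ⟩ := ih
    have hmono : ∀ x y, τ.SameCycle x y → Relation.EqvGen
        (fun x y => σ.SameCycle x y ∨ (x ∈ insert d T ∧ y = α x)) x y := by
      intro x y h
      refine Relation.EqvGen.mono ?_ _ _ ((hτ x y).1 h)
      rintro a b (h | ⟨h1, h2⟩)
      · exact Or.inl h
      · exact Or.inr ⟨Finset.mem_insert_of_mem h1, h2⟩
    by_cases hsc : τ.SameCycle d (α d)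
    · refine ⟨τ, ?_, fun x y => ⟨hmono x y, fun h => ?_⟩⟩
      · exact hτp.mono (by simp)
      induction h with
      | rel x y h =>
        rcases h with h | ⟨h1, rfl⟩
        · exact (hτ x y).2 (.rel _ _ (Or.inl h))
        · rcases Finset.mem_insert.1 h1 with rfl | h1
          · exact hsc
          · exact (hτ _ _).2 (.rel _ _ (Or.inr ⟨h1, rfl⟩))
      | refl x => exact Perm.SameCycle.refl _ _
      | symm x y _ ih => exact ih.symm
      | trans x y z _ _ ih1 ih2 => exact ih1.trans ih2
    · have hd' : α d ∉ T := fun h => hsc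
        (((hτ _ _).2 (.rel _ _ (Or.inr ⟨h, (hα d).symm⟩))).symm)
      set b := τ⁻¹ (α d) with hb
      have hbα : τ.SameCycle b (α d) := by
        have := sameCycle_self_apply τ b
        rwa [hb, ← Perm.mul_apply, mul_inv_cancel, Perm.one_apply, ← hb] at this
      have hnb : ¬ τ.SameCycle d b := fun h => hsc (h.trans hbα)
      have key := sameCycle_mul_swap_iff τ hnb (Perm.SameCycle.setoid τ) (fun _ _ => Iff.rfl)
      have hle : ∀ x y, τ.SameCycle x y → (τ * swap d b).SameCycle x y := fun x y h =>
        (key x y).2 (.rel _ _ (Or.inl h))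
      have hdb : (τ * swap d b).SameCycle d b := (key d b).2 (.rel _ _ (Or.inr ⟨rfl, rfl⟩))
      refine ⟨τ * swap d b, ?_, fun x y => ⟨fun h => ?_, fun h => ?_⟩⟩
      · rw [Finset.coe_insert]
        refine hτp.contract hα (by simpa using hd) (by simpa using hd') hsc fun x y => ?_
        rw [← hb]
        constructor
        · intro h
          replace h := (key x y).1 h
          induction h with
          | rel x y h =>
            rcases h with h | ⟨rfl, rfl⟩
            · exact Or.inl h
            · exact Or.inr (Or.inl ⟨Perm.SameCycle.refl _ _, hbα.symm⟩)
          | refl x => exact Or.inl (Perm.SameCycle.refl _ _)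
          | symm x y _ ih =>
            rcases ih with h | ⟨h1, h2⟩ | ⟨h1, h2⟩
            · exact Or.inl h.symm
            · exact Or.inr (Or.inr ⟨h2.symm, h1.symm⟩)
            · exact Or.inr (Or.inl ⟨h2.symm, h1.symm⟩)
          | trans x y z _ _ ih1 ih2 =>
            rcases ih1 with h | ⟨h1, h2⟩ | ⟨h1, h2⟩ <;>
              rcases ih2 with h' | ⟨h1', h2'⟩ | ⟨h1', h2'⟩
            · exact Or.inl (h.trans h')
            · exact Or.inr (Or.inl ⟨h.trans h1', h2'⟩)
            · exact Or.inr (Or.inr ⟨h.trans h1', h2'⟩)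
            · exact Or.inr (Or.inl ⟨h1, h2.trans h'⟩)
            · exact absurd (h2.trans h1').symm hsc
            · exact Or.inl (h1.trans h2')
            · exact Or.inr (Or.inr ⟨h1, h2.trans h'⟩)
            · exact Or.inl (h1.trans h2')
            · exact absurd (h2.trans h1') hsc
        · rintro (h | ⟨h1, h2⟩ | ⟨h1, h2⟩)
          · exact hle _ _ h
          · exact (hle _ _ h1).trans (hdb.trans (hle _ _ (hbα.trans h2)))
          · exact (hle _ _ (h1.trans hbα.symm)).trans (hdb.symm.trans (hle _ _ h2))
      · replace h := (key x y).1 h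
        induction h with
        | rel x y h =>
          rcases h with h | ⟨rfl, rfl⟩
          · exact hmono _ _ h
          · exact .trans _ _ _ (.rel _ _ (Or.inr ⟨Finset.mem_insert_self _ _, rfl⟩))
              (hmono _ _ hbα.symm)
        | refl x => exact .refl _
        | symm x y _ ih => exact .symm _ _ ih
        | trans x y z _ _ ih1 ih2 => exact .trans _ _ _ ih1 ih2
      · induction h with
        | rel x y h =>
          rcases h with h | ⟨h1, rfl⟩
          · exact hle _ _ ((hτ x y).2 (.rel _ _ (Or.inl h)))
          · rcases Finset.mem_insert.1 h1 with rfl | h1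
            · exact hdb.trans (hle _ _ hbα)
            · exact hle _ _ ((hτ _ _).2 (.rel _ _ (Or.inr ⟨h1, rfl⟩)))
        | refl x => exact Perm.SameCycle.refl _ _
        | symm x y _ ih => exact ih.symm
        | trans x y z _ _ ih1 ih2 => exact ih1.trans ih2

/-- Deleting all edges outside the range of `ι` from a planar map. -/
theorem MapPlanar.exists_restrict {T : Set D} {σ : Perm D} {α : D → D} (hp : MapPlanar T σ α)
    {D' : Type*} [Fintype D'] (ι : D' → D) (hι : Function.Injective ι) (α' : D' → D')
    (hα' : ∀ d, ι (α' d) = α (ι d)) (hα : ∀ d, α (α d) = d) (hT : ∀ d, ι d ∉ T) :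
    ∃ τ : Perm D', (∀ x y, τ.SameCycle x y ↔ σ.SameCycle (ι x) (ι y)) ∧ MapPlanar ∅ τ α' := by
  classical
  obtain ⟨τ, hτ, hc⟩ := exists_firstReturn σ ι hι fun x =>
    ⟨orderOf σ, orderOf_pos_iff.2 (isOfFinOrder_of_finite σ), by rw [pow_orderOf_eq_one]; rfl⟩
  refine ⟨τ, hτ, fun z hz _ hs => ?_⟩
  set w : D → ZMod 2 := Function.extend ι z 0 with hw
  have hwι : ∀ x, w (ι x) = z x := fun x => hι.extend_apply z 0 x
  have hw0 : ∀ d, d ∉ Set.range ι → w d = 0 := fun d hd => by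
    rw [hw, Function.extend_apply' _ _ _ (by simpa using hd)]; rfl
  suffices h : (∀ d, w (α d) = w d) ∧ (∀ d ∈ T, w d = 0) ∧ ∀ d, cycleSum σ w d = 0 by
    obtain ⟨c, hc1, hc2⟩ := hp w h.1 h.2.1 h.2.2
    refine ⟨fun x => c (ι x), fun x => ?_, fun x => ?_⟩
    · change c (ι (τ x)) = c (ι x) + z x
      rw [hc c w hc1 hw0, hwι]
    · change c (ι (α' x)) = c (ι x) + z x
      rw [hα', hc2, hwι]
  refine ⟨?_, ?_, ?_⟩
  · intro d
    by_cases hd : d ∈ Set.range ι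
    · obtain ⟨x, rfl⟩ := hd
      rw [← hα', hwι, hwι, hz]
    · rw [hw0 d hd, hw0]
      rintro ⟨x, hx⟩
      exact hd ⟨α' x, by rw [hα', hx, hα]⟩
  · intro d hd
    exact hw0 d fun ⟨x, hx⟩ => hT x (hx ▸ hd)
  · intro d
    unfold cycleSum
    by_cases hd : ∃ x, σ.SameCycle d (ι x)
    · obtain ⟨x, hx⟩ := hd
      have h1 := hs x
      unfold cycleSum at h1
      rw [← h1, ← Finset.sum_filter_add_sum_filter_not _ (fun y => y ∈ Set.range ι)]
      rw [Finset.sum_eq_zero (s := Finset.filter (fun y => ¬ y ∈ Set.range ι) _), add_zero]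
      · symm
        refine Finset.sum_bij (fun y _ => ι y) ?_ ?_ ?_ ?_
        · intro y hy
          simp only [Finset.mem_filter, Finset.mem_univ, true_and] at hy ⊢
          exact ⟨hx.trans ((hτ _ _).1 hy), y, rfl⟩
        · intro a _ b _ h
          exact hι h
        · intro y hy
          simp only [Finset.mem_filter, Finset.mem_univ, true_and] at hy
          obtain ⟨h2, y, rfl⟩ := hy
          exact ⟨y, by simpa using (hτ _ _).2 (hx.symm.trans h2), rfl⟩
        · intro y _
          rw [hwι]
      · intro y hy
        simp only [Finset.mem_filter, Finset.mem_univ, true_and] at hy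
        exact hw0 y hy.2
    · refine Finset.sum_eq_zero fun y hy => hw0 y ?_
      simp only [Finset.mem_filter, Finset.mem_univ, true_and] at hy
      rintro ⟨x, rfl⟩
      exact hd ⟨x, hy⟩

end PlanarMaps

section Grid

/-- The four unit steps of the square grid, in counterclockwise order. -/
def gridStep : ZMod 4 → ℤ × ℤ := ![(1, 0), (0, 1), (-1, 0), (0, -1)]

/-- The darts of the square grid: a base point and a direction. -/
abbrev GridDart : Type := (ℤ × ℤ) × ZMod 4

/-- The counterclockwise rotation of the grid darts around their base points. -/
def gridRot : Perm GridDart := (Equiv.refl _).prodCongr (Equiv.addRight 1)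

/-- The reversal of grid darts. -/
def gridRev (d : GridDart) : GridDart := (d.1 + gridStep d.2, d.2 + 2)

theorem gridStep_add_two (k : ZMod 4) : gridStep (k + 2) = -gridStep k := by
  revert k
  decide

theorem gridRev_gridRev (d : GridDart) : gridRev (gridRev d) = d := by
  obtain ⟨p, k⟩ := d
  have h : ∀ k : ZMod 4, k + 2 + 2 = k := by decide
  simp [gridRev, gridStep_add_two, h]

theorem gridRot_pow (n : ℕ) (d : GridDart) : (gridRot ^ n) d = (d.1, d.2 + n) := by
  induction n with
  | zero => simp
  | succ n ih =>
    rw [pow_succ', Perm.mul_apply, ih]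
    simp [gridRot, add_assoc]

theorem gridRot_sameCycle {x y : GridDart} : gridRot.SameCycle x y ↔ x.1 = y.1 := by
  constructor
  · exact rel_of_sameCycle (Setoid.ker (fun x : GridDart => x.1)) fun x => rfl
  · intro h
    refine ⟨((y.2 - x.2).val : ℕ), ?_⟩
    rw [zpow_natCast, gridRot_pow]
    simp [h]

theorem exists_grid_coloring (S : Finset GridDart) (z : GridDart → ZMod 2)
    (hz : ∀ d, z (gridRev d) = z d) (hS : ∀ d, d ∉ S → z d = 0)
    (hs : ∀ p, ∑ k, z (p, k) = 0) :
    ∃ c : GridDart → ZMod 2, (∀ d, c (gridRot d) = c d + z d) ∧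
      ∀ d, c (gridRev d) = c d + z d := by
  classical
  set a : ℤ → ℤ → ZMod 2 := fun i j => ∑ d ∈ S with d.1.1 = i ∧ j < d.1.2 ∧ d.2 = 0, z d with ha
  have hrow : ∀ i j, a i (j - 1) = a i j + z ((i, j), 0) := by
    intro i j
    have h1 : ({d ∈ S | d.1.1 = i ∧ j - 1 < d.1.2 ∧ d.2 = 0} : Finset GridDart) =
        {d ∈ S | d.1.1 = i ∧ j < d.1.2 ∧ d.2 = 0} ∪ {d ∈ S | d = ((i, j), 0)} := by
      ext ⟨⟨p, q⟩, k⟩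
      simp only [Finset.mem_filter, Finset.mem_union, Prod.mk.injEq]
      constructor
      · rintro ⟨h1, h2, h3, h4⟩
        by_cases h : j < q
        · exact Or.inl ⟨h1, h2, h, h4⟩
        · exact Or.inr ⟨h1, ⟨h2, by omega⟩, h4⟩
      · rintro (⟨h1, h2, h3, h4⟩ | ⟨h1, ⟨h2, h3⟩, h4⟩)
        · exact ⟨h1, h2, by omega, h4⟩
        · exact ⟨h1, h2, by omega, h4⟩
    rw [ha]
    simp only
    rw [h1, Finset.sum_union]
    · congr 1
      by_cases h : ((i, j), (0 : ZMod 4)) ∈ S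
      · rw [Finset.filter_eq', if_pos h, Finset.sum_singleton]
      · rw [Finset.filter_eq', if_neg h, Finset.sum_empty, hS _ h]
    · rw [Finset.disjoint_filter]
      rintro ⟨⟨p, q⟩, k⟩ _ ⟨_, h2, _⟩ h3
      simp only [Prod.mk.injEq] at h3
      simp only at h2
      omega
  have hz2 : ∀ i j, z ((i, j), 2) = z ((i - 1, j), 0) := by
    intro i j
    rw [← hz ((i, j), 2)]
    congr 1
    simp only [gridRev, Prod.mk.injEq]
    refine ⟨?_, by decide⟩
    change (i, j) + (-1, 0) = _
    simp [sub_eq_add_neg]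
  have hz3 : ∀ i j, z ((i, j), 3) = z ((i, j - 1), 1) := by
    intro i j
    rw [← hz ((i, j), 3)]
    congr 1
    simp only [gridRev, Prod.mk.injEq]
    refine ⟨?_, by decide⟩
    change (i, j) + (0, -1) = _
    simp [sub_eq_add_neg]
  have hsum : ∀ i j, z ((i, j), 0) + z ((i, j), 1) + z ((i - 1, j), 0) + z ((i, j - 1), 1) = 0 := by
    intro i j
    rw [← hz2, ← hz3, ← hs (i, j)]
    exact (Fin.sum_univ_four (fun k : Fin 4 => z ((i, j), k))).symm
  have hcol : ∀ i j, a i j + a (i - 1) j = z ((i, j), 1) := by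
    intro i j
    have step : ∀ j, a i (j - 1) + a (i - 1) (j - 1) + z ((i, j - 1), 1) =
        a i j + a (i - 1) j + z ((i, j), 1) := by
      intro j
      rw [hrow, hrow]
      have h := hsum i j
      have e1 := zmod_two_add_self (z ((i, j), 1))
      linear_combination h - e1
    have iter : ∀ n : ℕ, a i j + a (i - 1) j + z ((i, j), 1) =
        a i (j + n) + a (i - 1) (j + n) + z ((i, j + n), 1) := by
      intro n
      induction n with
      | zero => simp
      | succ n ih =>
        rw [ih, ← step (j + (n + 1 : ℕ))]
        have : j + ((n + 1 : ℕ) : ℤ) - 1 = j + n := by push_cast; ring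
        rw [this]
    obtain ⟨M, hM⟩ : ∃ M : ℤ, ∀ d ∈ S, d.1.2 < M := by
      obtain ⟨M, hM⟩ := (S.image fun d => d.1.2).bddAbove
      exact ⟨M + 1, fun d hd => Int.lt_add_one_iff.2
        (hM (Finset.mem_coe.2 (Finset.mem_image_of_mem _ hd)))⟩
    have hn : M ≤ j + ((M - j).toNat : ℤ) := by have := Int.self_le_toNat (M - j); omega
    have ha0 : ∀ i, a i (j + ((M - j).toNat : ℤ)) = 0 := by
      intro i
      rw [ha]
      refine Finset.sum_eq_zero fun d hd => ?_
      rw [Finset.mem_filter] at hd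
      have := hM d hd.1
      have := hd.2.2.1
      omega
    have hz0 : z ((i, j + ((M - j).toNat : ℤ)), 1) = 0 := hS _ fun h => by
      have := hM _ h
      simp only at this
      omega
    have h := iter (M - j).toNat
    rw [ha0, ha0, hz0, add_zero, add_zero] at h
    have e1 := zmod_two_add_self (z ((i, j), 1))
    linear_combination h - e1
  have hrow' : ∀ i j, a i j = a i (j - 1) + z ((i, j), 0) := by
    intro i j
    have e1 := zmod_two_add_self (z ((i, j), 0))
    linear_combination -hrow i j - e1
  have hcol' : ∀ i j, a (i - 1) j = a i j + z ((i, j), 1) := by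
    intro i j
    have e1 := zmod_two_add_self (a i j)
    linear_combination hcol i j - e1
  refine ⟨fun d => (![a d.1.1 (d.1.2 - 1), a d.1.1 d.1.2, a (d.1.1 - 1) d.1.2,
    a (d.1.1 - 1) (d.1.2 - 1)] : ZMod 4 → ZMod 2) d.2, ?_, ?_⟩
  · rintro ⟨⟨i, j⟩, k⟩
    change Fin 4 at k
    fin_cases k
    · exact hrow' i j
    · exact hcol' i j
    · change a (i - 1) (j - 1) = a (i - 1) j + z ((i, j), 2)
      rw [hz2]
      exact hrow _ _
    · change a i (j - 1) = a (i - 1) (j - 1) + z ((i, j), 3)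
      rw [hz3, hcol']
      have e1 := zmod_two_add_self (z ((i, j - 1), 1))
      linear_combination -e1
  · rintro ⟨⟨i, j⟩, k⟩
    change Fin 4 at k
    fin_cases k
    · change a (i + 1 - 1) (j + 0) = a i (j - 1) + z ((i, j), 0)
      rw [add_sub_cancel_right, add_zero]
      exact hrow' i j
    · change a (i + 0 - 1) (j + 1 - 1) = a i j + z ((i, j), 1)
      rw [add_sub_cancel_right, add_zero]
      exact hcol' i j
    · change a (i - 1) (j + 0 - 1) = a (i - 1) j + z ((i, j), 2)
      rw [hz2, add_zero]
      exact hrow _ _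
    · change a (i + 0) (j - 1) = a (i - 1) (j - 1) + z ((i, j), 3)
      rw [hz3, hcol', add_zero]
      have e1 := zmod_two_add_self (z ((i, j - 1), 1))
      linear_combination -e1

theorem exists_gridMap (S : Finset GridDart) (hS : ∀ d ∈ S, gridRev d ∈ S) :
    ∃ σ : Perm S, (∀ x y, σ.SameCycle x y ↔ x.1.1 = y.1.1) ∧
      MapPlanar ∅ σ (fun d => ⟨gridRev d, hS d d.2⟩) := by
  classical
  obtain ⟨τ, hτ, hc⟩ := exists_firstReturn gridRot (Subtype.val : S → GridDart)
    Subtype.val_injective fun x => ⟨4, by norm_num, by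
      rw [gridRot_pow]
      ext1
      · rfl
      · change x.1.2 + ((4 : ℕ) : ZMod 4) = _
        rw [ZMod.natCast_self, add_zero]⟩
  have hτ' : ∀ x y : S, τ.SameCycle x y ↔ x.1.1 = y.1.1 := fun x y => by
    rw [hτ, gridRot_sameCycle]
  refine ⟨τ, hτ', fun z hz _ hs => ?_⟩
  set w : GridDart → ZMod 2 := fun d => if h : d ∈ S then z ⟨d, h⟩ else 0 with hw
  have hwS : ∀ x : S, w x = z x := fun x => by simp [hw]
  have hw0 : ∀ d, d ∉ S → w d = 0 := fun d hd => by simp [hw, hd]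
  obtain ⟨c, hc1, hc2⟩ := exists_grid_coloring S w (fun d => by
      by_cases hd : d ∈ S
      · have := hz ⟨d, hd⟩
        rw [← hwS, ← hwS] at this
        exact this
      · rw [hw0 d hd, hw0]
        intro h
        exact hd (gridRev_gridRev d ▸ hS _ h)) hw0 (fun p => by
      by_cases hp : ∃ x : S, x.1.1 = p
      · obtain ⟨x, rfl⟩ := hp
        rw [← hs x]
        unfold cycleSum
        simp only [hτ', ← hwS]
        rw [Finset.sum_filter, Finset.sum_coe_sort S (fun d => if x.1.1 = d.1 then w d else 0),
          ← Finset.sum_filter]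
        rw [← Finset.sum_image (s := Finset.univ) (g := fun k => (x.1.1, k)) (f := w)]
        · symm
          refine Finset.sum_subset ?_ ?_
          · rintro ⟨q, k⟩ hd
            rw [Finset.mem_filter] at hd
            rw [Finset.mem_image]
            exact ⟨k, Finset.mem_univ _, by rw [hd.2]⟩
          · intro d hd hd'
            obtain ⟨k, _, rfl⟩ := Finset.mem_image.1 hd
            refine hw0 _ fun h => hd' (Finset.mem_filter.2 ⟨h, rfl⟩)
        · intro a _ b _ h
          exact (Prod.mk.inj h).2
      · exact Finset.sum_eq_zero fun k _ => hw0 _ fun h => hp ⟨⟨_, h⟩, rfl⟩)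
  refine ⟨fun x => c x, fun x => ?_, fun x => ?_⟩
  · change c (τ x) = c x + z x
    rw [hc c w hc1 (fun d hd => hw0 d (by simpa using hd)), hwS]
  · change c (gridRev x) = c x + z x
    rw [hc2, hwS]

end Grid

section Cells

/-- Connection of two cells by a path of grid steps inside `C`. -/
def CellConn (C : Set (ℤ × ℤ)) : ℤ × ℤ → ℤ × ℤ → Prop :=
  Relation.ReflTransGen fun x y => x ∈ C ∧ y ∈ C ∧ ∃ k, y = x + gridStep k

theorem CellConn.symm {C : Set (ℤ × ℤ)} {x y : ℤ × ℤ} (h : CellConn C x y) : CellConn C y x := by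
  have hs : Std.Symm fun x y : ℤ × ℤ => x ∈ C ∧ y ∈ C ∧ ∃ k, y = x + gridStep k := by
    refine ⟨?_⟩
    rintro x y ⟨hx, hy, k, rfl⟩
    exact ⟨hy, hx, k + 2, by rw [gridStep_add_two, add_neg_cancel_right]⟩
  exact Relation.ReflTransGen.stdSymm.symm _ _ h

theorem CellConn.trans {C : Set (ℤ × ℤ)} {x y z : ℤ × ℤ} (h : CellConn C x y)
    (h' : CellConn C y z) : CellConn C x z :=
  Relation.ReflTransGen.trans h h'

theorem CellConn.mono {C C' : Set (ℤ × ℤ)} (hC : C ⊆ C') {x y : ℤ × ℤ} (h : CellConn C x y) :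
    CellConn C' x y :=
  Relation.ReflTransGen.mono (fun _ _ ⟨h1, h2, h3⟩ => ⟨hC h1, hC h2, h3⟩) _ _ h

theorem cellConn_right {C : Set (ℤ × ℤ)} {i i' j : ℤ} (hi : i ≤ i')
    (hC : ∀ m, i ≤ m → m ≤ i' → (m, j) ∈ C) : CellConn C (i, j) (i', j) := by
  induction i', hi using Int.leInduction with
  | base => exact .refl
  | succ m hm ih =>
    refine (ih fun l h1 h2 => hC l h1 (by omega)).tail ⟨hC _ hm (by omega), hC _ (by omega) le_rfl,
      0, ?_⟩
    change _ = (m, j) + (1, 0)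
    simp

theorem cellConn_up {C : Set (ℤ × ℤ)} {i j j' : ℤ} (hj : j ≤ j')
    (hC : ∀ m, j ≤ m → m ≤ j' → (i, m) ∈ C) : CellConn C (i, j) (i, j') := by
  induction j', hj using Int.leInduction with
  | base => exact .refl
  | succ m hm ih =>
    refine (ih fun l h1 h2 => hC l h1 (by omega)).tail ⟨hC _ hm (by omega), hC _ (by omega) le_rfl,
      1, ?_⟩
    change _ = (i, m) + (0, 1)
    simp

/-- The cells at distance at most two from `K`. -/
def cellNbhd (K : Set (ℝ × ℝ)) : Set (ℤ × ℤ) :=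
  {x | ∃ k ∈ K, |(x.1 : ℝ) - k.1| ≤ 2 ∧ |(x.2 : ℝ) - k.2| ≤ 2}

/-- The cell containing a point. -/
noncomputable def cellOf (p : ℝ × ℝ) : ℤ × ℤ := (⌊p.1⌋, ⌊p.2⌋)

theorem cellOf_mem {K : Set (ℝ × ℝ)} {p : ℝ × ℝ} (hp : p ∈ K) : cellOf p ∈ cellNbhd K := by
  refine ⟨p, hp, ?_, ?_⟩ <;>
  · rw [abs_le]
    constructor <;> simp only [cellOf] <;>
      linarith [Int.floor_le p.1, Int.lt_floor_add_one p.1, Int.floor_le p.2,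
        Int.lt_floor_add_one p.2]

theorem cellConn_of_box {K : Set (ℝ × ℝ)} {k : ℝ × ℝ} (hk : k ∈ K) {x y : ℤ × ℤ}
    (hx : |(x.1 : ℝ) - k.1| ≤ 2 ∧ |(x.2 : ℝ) - k.2| ≤ 2)
    (hy : |(y.1 : ℝ) - k.1| ≤ 2 ∧ |(y.2 : ℝ) - k.2| ≤ 2) : CellConn (cellNbhd K) x y := by
  obtain ⟨i, j⟩ := x
  obtain ⟨i', j'⟩ := y
  simp only [abs_le] at hx hy
  have hmem : ∀ m n : ℤ, min i i' ≤ m → m ≤ max i i' → min j j' ≤ n → n ≤ max j j' →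
      (m, n) ∈ cellNbhd K := by
    intro m n h1 h2 h3 h4
    have h1' : min (i : ℝ) i' ≤ m := by exact_mod_cast h1
    have h2' : (m : ℝ) ≤ max (i : ℝ) i' := by exact_mod_cast h2
    have h3' : min (j : ℝ) j' ≤ n := by exact_mod_cast h3
    have h4' : (n : ℝ) ≤ max (j : ℝ) j' := by exact_mod_cast h4
    refine ⟨k, hk, ?_, ?_⟩
    · rw [abs_le]
      constructor
      · have : k.1 - 2 ≤ min (i : ℝ) i' := le_min (by linarith) (by linarith)
        linarith
      · have : max (i : ℝ) i' ≤ k.1 + 2 := max_le (by linarith) (by linarith)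
        linarith
    · rw [abs_le]
      constructor
      · have : k.2 - 2 ≤ min (j : ℝ) j' := le_min (by linarith) (by linarith)
        linarith
      · have : max (j : ℝ) j' ≤ k.2 + 2 := max_le (by linarith) (by linarith)
        linarith
  refine CellConn.trans (y := (i', j)) ?_ ?_
  · rcases le_total i i' with h | h
    · exact cellConn_right h fun m h1 h2 => hmem _ _ (by omega) (by omega) (by omega) (by omega)
    · exact (cellConn_right h fun m h1 h2 =>
        hmem _ _ (by omega) (by omega) (by omega) (by omega)).symm
  · rcases le_total j j' with h | h
    · exact cellConn_up h fun m h1 h2 => hmem _ _ (by omega) (by omega) (by omega) (by omega)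
    · exact (cellConn_up h fun m h1 h2 =>
        hmem _ _ (by omega) (by omega) (by omega) (by omega)).symm

theorem cellConn_of_isPreconnected {K : Set (ℝ × ℝ)} (hK : IsPreconnected K) {x y : ℤ × ℤ}
    (hx : x ∈ cellNbhd K) (hy : y ∈ cellNbhd K) : CellConn (cellNbhd K) x y := by
  have hfl : ∀ p : ℝ × ℝ, |((cellOf p).1 : ℝ) - p.1| ≤ 1 ∧ |((cellOf p).2 : ℝ) - p.2| ≤ 1 := by
    intro p
    constructor <;>
    · rw [abs_le]
      constructor <;> simp only [cellOf] <;>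
        linarith [Int.floor_le p.1, Int.lt_floor_add_one p.1, Int.floor_le p.2,
          Int.lt_floor_add_one p.2]
  have hconn : ∀ p ∈ K, ∀ q ∈ K, CellConn (cellNbhd K) (cellOf p) (cellOf q) := by
    intro p hp q hq
    refine hK.induction₂ (fun p q => CellConn (cellNbhd K) (cellOf p) (cellOf q)) ?_
      (fun _ _ _ _ _ _ h1 h2 => h1.trans h2) (fun _ _ _ _ h => h.symm) hp hq
    intro a ha
    refine Filter.Eventually.filter_mono nhdsWithin_le_nhds ?_
    filter_upwards [Metric.ball_mem_nhds a zero_lt_one] with b hb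
    rw [Metric.mem_ball, Prod.dist_eq, max_lt_iff, Real.dist_eq, Real.dist_eq] at hb
    refine cellConn_of_box ha ⟨(hfl a).1.trans (by norm_num), (hfl a).2.trans (by norm_num)⟩
      ⟨?_, ?_⟩
    · have h1 := (hfl b).1
      have h2 := hb.1.le
      rw [abs_le] at *
      constructor <;> linarith
    · have h1 := (hfl b).2
      have h2 := hb.2.le
      rw [abs_le] at *
      constructor <;> linarith
  obtain ⟨k, hk, hxk⟩ := hx
  obtain ⟨l, hl, hyl⟩ := hy
  have hb : ∀ p : ℝ × ℝ, |((cellOf p).1 : ℝ) - p.1| ≤ 2 ∧ |((cellOf p).2 : ℝ) - p.2| ≤ 2 :=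
    fun p => ⟨(hfl p).1.trans (by norm_num), (hfl p).2.trans (by norm_num)⟩
  exact ((cellConn_of_box hk hxk (hb k)).trans (hconn k hk l hl)).trans
    (cellConn_of_box hl (hb l) hyl)

theorem finite_cellNbhd {K : Set (ℝ × ℝ)} (hK : Bornology.IsBounded K) :
    (cellNbhd K).Finite := by
  obtain ⟨R, hR⟩ := hK.subset_closedBall 0
  refine ((Set.finite_Icc ⌊-R - 2⌋ ⌈R + 2⌉).prod (Set.finite_Icc ⌊-R - 2⌋ ⌈R + 2⌉)).subset ?_
  rintro ⟨i, j⟩ ⟨k, hk, h1, h2⟩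
  have h3 := hR hk
  rw [Metric.mem_closedBall, Prod.dist_eq, max_le_iff, Real.dist_eq, Real.dist_eq] at h3
  obtain ⟨h3, h4⟩ := h3
  simp only [Prod.fst_zero, Prod.snd_zero, sub_zero] at h3 h4
  rw [abs_le] at *
  simp only at h1 h2
  refine ⟨⟨Int.floor_le_iff.2 ?_, Int.le_ceil_iff.2 ?_⟩, Int.floor_le_iff.2 ?_,
    Int.le_ceil_iff.2 ?_⟩ <;> simp only <;> linarith

/-- If the cell neighbourhoods of two sets contain equal or adjacent cells, the sets are close. -/
theorem exists_dist_lt_of_cellNbhd {K K' : Set (ℝ × ℝ)} {x y : ℤ × ℤ} (hx : x ∈ cellNbhd K)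
    (hy : y ∈ cellNbhd K') (hxy : y = x ∨ ∃ k, y = x + gridStep k) :
    ∃ p ∈ K, ∃ q ∈ K', dist p q < 10 := by
  obtain ⟨p, hp, h1, h2⟩ := hx
  obtain ⟨q, hq, h3, h4⟩ := hy
  refine ⟨p, hp, q, hq, ?_⟩
  have hd : |(y.1 : ℝ) - x.1| ≤ 1 ∧ |(y.2 : ℝ) - x.2| ≤ 1 := by
    have : |y.1 - x.1| ≤ 1 ∧ |y.2 - x.2| ≤ 1 := by
      rcases hxy with rfl | ⟨k, rfl⟩
      · simp
      · simp only [Prod.fst_add, Prod.snd_add, add_sub_cancel_left]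
        exact (by decide : ∀ k, |(gridStep k).1| ≤ 1 ∧ |(gridStep k).2| ≤ 1) k
    exact_mod_cast this
  obtain ⟨h5, h6⟩ := hd
  rw [Prod.dist_eq, max_lt_iff, Real.dist_eq, Real.dist_eq, abs_lt, abs_lt]
  rw [abs_le] at *
  refine ⟨⟨?_, ?_⟩, ?_, ?_⟩ <;> linarith

end Cells

section ThickArcs

/-- Paths of cells lift to chains of darts. -/
theorem eqvGen_of_cellConn {S : Finset GridDart} {R : S → S → Prop} {C : Set (ℤ × ℤ)}
    {x y : ℤ × ℤ} (h : CellConn C x y)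
    (hbase : ∀ d d' : S, d.1.1 = d'.1.1 → R d d')
    (hstep : ∀ x ∈ C, ∀ k, x + gridStep k ∈ C →
      ∃ d d' : S, d.1 = (x, k) ∧ d'.1 = gridRev (x, k) ∧ R d d')
    (d d' : S) (hd : d.1.1 = x) (hd' : d'.1.1 = y) : Relation.EqvGen R d d' := by
  induction h using Relation.ReflTransGen.head_induction_on generalizing d with
  | refl => exact .rel _ _ (hbase _ _ (hd.trans hd'.symm))
  | head h _ ih =>
    obtain ⟨h1, h2, k, rfl⟩ := h
    obtain ⟨e, e', he, he', hR⟩ := hstep _ h1 k h2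
    refine .trans _ _ _ (.rel _ _ (hbase d e (by rw [hd, he])))
      (.trans _ _ _ (.rel _ _ hR) (ih e' (by rw [he']; rfl)))

theorem exists_mapPlanar_of_separated {A : Type*} [Fintype A] (P : A → Bool → Set (ℝ × ℝ))
    (M : A → Set (ℝ × ℝ)) (p : A → Bool → ℝ × ℝ)
    (hPc : ∀ a i, IsPreconnected (P a i)) (hMc : ∀ a, IsPreconnected (M a))
    (hPb : ∀ a i, Bornology.IsBounded (P a i)) (hMb : ∀ a, Bornology.IsBounded (M a))
    (hp : ∀ a i, p a i ∈ P a i) (hPM : ∀ a i, (P a i ∩ M a).Nonempty)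
    (hpa : ∀ a, p a false ≠ p a true)
    (hPP : ∀ a i b j, p a i ≠ p b j → ∀ x ∈ P a i, ∀ y ∈ P b j, 10 ≤ dist x y)
    (hMM : ∀ a b, a ≠ b → ∀ x ∈ M a, ∀ y ∈ M b, 10 ≤ dist x y)
    (hMP : ∀ a b j, a ≠ b → ∀ x ∈ M a, ∀ y ∈ P b j, 10 ≤ dist x y) :
    ∃ σ : Perm (A × Bool), (∀ x y, σ.SameCycle x y ↔ p x.1 x.2 = p y.1 y.2) ∧
      MapPlanar ∅ σ fun x => (x.1, !x.2) := by
  classical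
  set B : ℝ × ℝ → ℤ × ℤ → Prop := fun q x => ∃ a i, p a i = q ∧ x ∈ cellNbhd (P a i) with hB
  set Mid : A → ℤ × ℤ → Prop := fun a x => x ∈ cellNbhd (M a) ∧ ∀ q, ¬ B q x with hMid
  set L : ℝ × ℝ → ℤ × ℤ → Prop := fun q x => B q x ∨ ∃ a, Mid a x ∧ p a true = q with hL
  have hBB : ∀ q q' x y, B q x → B q' y → (y = x ∨ ∃ k, y = x + gridStep k) → q = q' := by
    rintro q q' x y ⟨a, i, rfl, hx⟩ ⟨b, j, rfl, hy⟩ hxy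
    by_contra hne
    obtain ⟨u, hu, v, hv, h⟩ := exists_dist_lt_of_cellNbhd hx hy hxy
    exact absurd (hPP a i b j hne u hu v hv) (not_le.2 h)
  have hMidU : ∀ a b x, x ∈ cellNbhd (M a) → x ∈ cellNbhd (M b) → a = b := by
    intro a b x hx hy
    by_contra hne
    obtain ⟨u, hu, v, hv, h⟩ := exists_dist_lt_of_cellNbhd hx hy (Or.inl rfl)
    exact absurd (hMM a b hne u hu v hv) (not_le.2 h)
  have hMPU : ∀ a b j x, x ∈ cellNbhd (M a) → x ∈ cellNbhd (P b j) → a = b := by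
    intro a b j x hx hy
    by_contra hne
    obtain ⟨u, hu, v, hv, h⟩ := exists_dist_lt_of_cellNbhd hx hy (Or.inl rfl)
    exact absurd (hMP a b j hne u hu v hv) (not_le.2 h)
  have hLU : ∀ q q' x, L q x → L q' x → q = q' := by
    rintro q q' x (h | ⟨a, h, rfl⟩) (h' | ⟨b, h', rfl⟩)
    · exact hBB q q' x x h h' (Or.inl rfl)
    · exact absurd h (h'.2 _)
    · exact absurd h' (h.2 _)
    · rw [hMidU a b x h.1 h'.1]
  have hBL : ∀ {q x}, B q x → L q x := fun h => Or.inl h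
  have hBconn : ∀ a i x, x ∈ cellNbhd (P a i) →
      CellConn {y | L (p a i) y} x (cellOf (p a i)) := fun a i x hx =>
    (cellConn_of_isPreconnected (hPc a i) hx (cellOf_mem (hp a i))).mono
      fun y hy => hBL ⟨a, i, rfl, hy⟩
  have hBconn' : ∀ q x, B q x → CellConn {y | L q y} x (cellOf q) := by
    rintro q x ⟨a, i, rfl, hx⟩
    exact hBconn a i x hx
  -- the switch from one label to the other along an arc
  have hsw : ∀ a, ∃ y k, B (p a false) y ∧ Mid a (y + gridStep k) ∧
      CellConn {z | L (p a true) z} (y + gridStep k) (cellOf (p a true)) := by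
    intro a
    have hconn : IsPreconnected (P a true ∪ (M a ∪ P a false)) := by
      obtain ⟨u, hu1, hu2⟩ := hPM a true
      obtain ⟨v, hv1, hv2⟩ := hPM a false
      exact (hPc a true).union u hu1 (Or.inl hu2) ((hMc a).union v hv2 hv1 (hPc a false))
    have hpath := cellConn_of_isPreconnected hconn
      (cellOf_mem (Or.inl (hp a true))) (cellOf_mem (Or.inr (Or.inr (hp a false))))
    have hcell : ∀ x ∈ cellNbhd (P a true ∪ (M a ∪ P a false)),
        B (p a true) x ∨ Mid a x ∨ B (p a false) x := by
      rintro x ⟨k, hk | hk | hk, hx⟩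
      · exact Or.inl ⟨a, true, rfl, k, hk, hx⟩
      · by_cases h : ∃ q, B q x
        · obtain ⟨q, b, j, rfl, h⟩ := h
          have := hMPU a b j x ⟨k, hk, hx⟩ h
          subst this
          cases j
          · exact Or.inr (Or.inr ⟨a, _, rfl, h⟩)
          · exact Or.inl ⟨a, _, rfl, h⟩
        · exact Or.inr (Or.inl ⟨⟨k, hk, hx⟩, fun q hq => h ⟨q, hq⟩⟩)
      · exact Or.inr (Or.inr ⟨a, false, rfl, k, hk, hx⟩)
    by_contra hno
    have key : ∀ z, CellConn (cellNbhd (P a true ∪ (M a ∪ P a false))) (cellOf (p a true)) z →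
        L (p a true) z ∧ CellConn {z | L (p a true) z} z (cellOf (p a true)) := by
      intro z hz
      induction hz with
      | refl => exact ⟨hBL ⟨a, true, rfl, cellOf_mem (hp a true)⟩, .refl⟩
      | @tail x y _ hxy ih =>
        obtain ⟨hx, hy, k, hk⟩ := hxy
        have hyL : L (p a true) y := by
          rcases hcell y hy with h | h | h
          · exact hBL h
          · exact Or.inr ⟨a, h, rfl⟩
          · exfalso
            rcases hcell x hx with h' | h' | h'
            · exact hpa a (hBB _ _ _ _ h' h (Or.inr ⟨k, hk⟩)).symm
            · refine hno ⟨y, k + 2, h, ?_⟩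
              rw [gridStep_add_two, hk, add_neg_cancel_right]
              exact ⟨h', ih.2⟩
            · exact hpa a (hLU _ _ x (hBL h') ih.1)
        refine ⟨hyL, ih.2.head ⟨hyL, ih.1, k + 2, ?_⟩⟩
        rw [gridStep_add_two, hk, add_neg_cancel_right]
    have h1 := (key _ hpath).1
    exact hpa a (hLU _ _ _ (hBL ⟨a, false, rfl, cellOf_mem (hp a false)⟩) h1)
  choose y k hy hmid hyconn using hsw
  have hfin : {x | ∃ q, L q x}.Finite := by
    refine Set.Finite.subset ((Set.finite_iUnion fun ai : A × Bool =>
      finite_cellNbhd (hPb ai.1 ai.2)).union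
        (Set.finite_iUnion fun a => finite_cellNbhd (hMb a))) ?_
    rintro x ⟨q, ⟨a, i, _, h⟩ | ⟨a, h, _⟩⟩
    · exact Or.inl (Set.mem_iUnion.2 ⟨(a, i), h⟩)
    · exact Or.inr (Set.mem_iUnion.2 ⟨a, h.1⟩)
  have hSfin : {d : GridDart | (∃ q, L q d.1) ∧ ∃ q, L q (gridRev d).1}.Finite :=
    (hfin.prod (Set.toFinite (Set.univ : Set (ZMod 4)))).subset fun d hd => ⟨hd.1, trivial⟩
  set S := hSfin.toFinset with hSdef
  have hS : ∀ d, d ∈ S ↔ (∃ q, L q d.1) ∧ ∃ q, L q (gridRev d).1 := fun d => by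
    rw [hSdef, Set.Finite.mem_toFinset]
    rfl
  have hSrev : ∀ d ∈ S, gridRev d ∈ S := fun d hd => by
    rw [hS] at hd ⊢
    rw [gridRev_gridRev]
    exact ⟨hd.2, hd.1⟩
  obtain ⟨σ, hσ, hplan⟩ := exists_gridMap S hSrev
  set α : S → S := fun d => ⟨gridRev d, hSrev d d.2⟩ with hαdef
  have hα : ∀ d, α (α d) = d := fun d => Subtype.ext (gridRev_gridRev d.1)
  set T : Finset S := {d | ∃ q, L q d.1.1 ∧ L q (gridRev d.1).1} with hT
  obtain ⟨τ, hτp, hτ⟩ := hplan.exists_contract hα T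
  have hd0 : ∀ a, (y a, k a) ∈ S := fun a => (hS _).2
    ⟨⟨_, hBL (hy a)⟩, _, Or.inr ⟨a, hmid a, rfl⟩⟩
  set ι : A × Bool → S := fun x => if x.2 then α ⟨_, hd0 x.1⟩ else ⟨_, hd0 x.1⟩ with hι
  have hιf : ∀ a, ι (a, false) = ⟨_, hd0 a⟩ := fun a => rfl
  have hιt : ∀ a, ι (a, true) = α ⟨_, hd0 a⟩ := fun a => rfl
  have hlab : ∀ a i, L (p a i) (ι (a, i)).1.1 := by
    intro a i
    cases i
    · exact hBL (hy a)
    · exact Or.inr ⟨a, hmid a, rfl⟩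
  have hιconn : ∀ a i, CellConn {z | L (p a i) z} (ι (a, i)).1.1 (cellOf (p a i)) := by
    intro a i
    cases i
    · exact hBconn' _ _ (hy a)
    · exact hyconn a
  have hιinj : Function.Injective ι := by
    rintro ⟨a, i⟩ ⟨b, j⟩ h
    have hB0 : ∀ a, B (p a false) (ι (a, false)).1.1 := hy
    have hM0 : ∀ a, Mid a (ι (a, true)).1.1 := hmid
    cases i <;> cases j
    · rw [hιf, hιf, Subtype.mk.injEq, Prod.mk.injEq] at h
      have h1 := hmid a
      rw [h.1, h.2] at h1
      rw [hMidU a b _ h1.1 (hmid b).1]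
    · exact absurd (hB0 a) (h ▸ (hM0 b).2 _)
    · exact absurd (hB0 b) (h ▸ (hM0 a).2 _)
    · have h1 := hM0 a
      rw [h] at h1
      rw [hMidU a b _ h1.1 (hM0 b).1]
  have hια : ∀ x : A × Bool, ι (x.1, !x.2) = α (ι x) := by
    rintro ⟨a, i⟩
    cases i
    · rfl
    · exact (hα _).symm
  have hιT : ∀ x, ι x ∉ (T : Set S) := by
    have h0 : ∀ a, ι (a, false) ∉ T := by
      intro a h
      rw [hT, Finset.mem_filter] at h
      obtain ⟨_, q, h1, h2⟩ := h
      have e1 := hLU _ _ _ h1 (hlab a false)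
      have e2 := hLU _ _ _ h2 (hlab a true)
      exact hpa a (e1.symm.trans e2)
    rintro ⟨a, i⟩ h
    cases i
    · exact h0 a h
    · refine h0 a ?_
      have h' : ι (a, true) ∈ T := h
      rw [hT, Finset.mem_filter] at h' ⊢
      obtain ⟨_, q, h1, h2⟩ := h'
      rw [hιt] at h1 h2
      rw [hιf]
      refine ⟨Finset.mem_univ _, q, ?_, h1⟩
      have : gridRev (α ⟨_, hd0 a⟩).1 = (y a, k a) := gridRev_gridRev _
      rwa [this] at h2
  obtain ⟨ρ, hρ, hρp⟩ := hτp.exists_restrict ι hιinj (fun x => (x.1, !x.2)) hια hα hιT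
  refine ⟨ρ, fun x x' => ?_, hρp⟩
  rw [hρ, hτ]
  constructor
  · intro h
    have key : ∀ d d', Relation.EqvGen (fun x y => σ.SameCycle x y ∨ (x ∈ T ∧ y = α x)) d d' →
        ∀ q, L q d.1.1 ↔ L q d'.1.1 := by
      intro d d' h
      induction h with
      | rel d d' h =>
        rcases h with h | ⟨h, rfl⟩
        · intro q
          rw [(hσ _ _).1 h]
        · rw [hT, Finset.mem_filter] at h
          obtain ⟨_, q, h1, h2⟩ := h
          intro q'
          constructor
          · intro h3
            rw [hLU _ _ _ h3 h1]
            exact h2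
          · intro h3
            rw [hLU _ _ _ h3 h2]
            exact h1
      | refl => exact fun _ => Iff.rfl
      | symm _ _ _ ih => exact fun q => (ih q).symm
      | trans _ _ _ _ _ ih1 ih2 => exact fun q => (ih1 q).trans (ih2 q)
    exact hLU _ _ _ ((key _ _ h _).1 (hlab x.1 x.2)) (hlab x'.1 x'.2)
  · intro h
    have h1 := hιconn x.1 x.2
    have h2 := hιconn x'.1 x'.2
    rw [← h] at h2
    refine eqvGen_of_cellConn (h1.trans h2.symm) (fun d d' h => Or.inl ((hσ _ _).2 h)) ?_ _ _
      rfl rfl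
    intro c hc l hl
    have hcS : (c, l) ∈ S := (hS _).2 ⟨⟨_, hc⟩, _, hl⟩
    refine ⟨⟨_, hcS⟩, α ⟨_, hcS⟩, rfl, rfl, Or.inr ⟨?_, rfl⟩⟩
    rw [hT, Finset.mem_filter]
    exact ⟨Finset.mem_univ _, _, hc, hl⟩

end ThickArcs

section Arcs

theorem exists_pos_forall_le_dist {ι : Type*} [Finite ι] (K K' : ι → Set (ℝ × ℝ))
    (hK : ∀ i, IsCompact (K i)) (hK' : ∀ i, IsCompact (K' i)) :
    ∃ N : ℝ, 0 < N ∧ ∀ i, Disjoint (K i) (K' i) → ∀ x ∈ K i, ∀ y ∈ K' i,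
      10 ≤ dist (N • x) (N • y) := by
  have h : ∀ i, ∃ N : ℝ, ∀ N', N ≤ N' → 0 < N' → Disjoint (K i) (K' i) → ∀ x ∈ K i, ∀ y ∈ K' i,
      10 ≤ dist (N' • x) (N' • y) := by
    intro i
    by_cases hd : Disjoint (K i) (K' i)
    · obtain ⟨δ, hδ, h⟩ := hd.exists_thickenings (hK i) (hK' i).isClosed
      refine ⟨10 / δ, fun N' hN hN0 _ x hx y hy => ?_⟩
      have h1 : δ ≤ dist x y := by
        by_contra hlt
        refine Set.disjoint_left.1 h (Metric.mem_thickening_iff.2 ⟨x, hx, ?_⟩)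
          (Metric.self_subset_thickening hδ _ hy)
        rw [dist_comm]
        exact not_le.1 hlt
      rw [dist_smul₀, Real.norm_of_nonneg hN0.le]
      rw [div_le_iff₀ hδ] at hN
      nlinarith
    · exact ⟨0, fun _ _ _ h => absurd h hd⟩
  choose N hN using h
  obtain ⟨B, hB⟩ := (Set.finite_range N).bddAbove
  refine ⟨max B 1, by positivity, fun i => hN i _ ?_ (by positivity)⟩
  exact (hB ⟨i, rfl⟩).trans (le_max_left _ _)

/-- A finite family of internally disjoint arcs in the plane is a planar map. -/
theorem exists_mapPlanar_of_arcs {A : Type*} [Fintype A] (γ : A → ℝ → ℝ × ℝ)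
    (hc : ∀ a, ContinuousOn (γ a) (Set.Icc 0 1)) (hi : ∀ a, Set.InjOn (γ a) (Set.Icc 0 1))
    (hd : ∀ a b, a ≠ b → ∀ s ∈ Set.Ioo (0 : ℝ) 1, ∀ t ∈ Set.Icc (0 : ℝ) 1, γ a s ≠ γ b t) :
    ∃ σ : Perm (A × Bool), (∀ x y, σ.SameCycle x y ↔
        γ x.1 (if x.2 then 1 else 0) = γ y.1 (if y.2 then 1 else 0)) ∧
      MapPlanar ∅ σ fun x => (x.1, !x.2) := by
  set I : Bool → Set ℝ := fun i => if i then Set.Icc (2 / 3) 1 else Set.Icc 0 (1 / 3) with hI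
  set J : Set ℝ := Set.Icc (1 / 3) (2 / 3) with hJ
  have hI01 : ∀ i, I i ⊆ Set.Icc 0 1 := by
    intro i
    cases i
    · exact Set.Icc_subset_Icc le_rfl (by norm_num)
    · exact Set.Icc_subset_Icc (by norm_num) le_rfl
  have hJ01 : J ⊆ Set.Icc 0 1 := Set.Icc_subset_Icc (by norm_num) (by norm_num)
  have hJo : J ⊆ Set.Ioo 0 1 := fun t ht => ⟨by linarith [ht.1], by linarith [ht.2]⟩
  have hIpc : ∀ i, IsPreconnected (I i) := by
    intro i
    cases i <;> exact isPreconnected_Icc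
  have hIcpt : ∀ i, IsCompact (I i) := by
    intro i
    cases i <;> exact isCompact_Icc
  have hIend : ∀ i, (if i then 1 else 0 : ℝ) ∈ I i := by
    intro i
    cases i <;> simp [hI] ; norm_num
  have hIJ : ∀ i, ∃ t, t ∈ I i ∧ t ∈ J := by
    intro i
    cases i
    · exact ⟨1 / 3, ⟨by norm_num, le_rfl⟩, le_rfl, by norm_num⟩
    · exact ⟨2 / 3, ⟨le_rfl, by norm_num⟩, by norm_num, le_rfl⟩
  have hIo : ∀ i, ∀ t ∈ I i, t ∈ Set.Ioo (0 : ℝ) 1 ∨ t = if i then 1 else 0 := by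
    intro i t ht
    cases i
    · have h1 : 0 ≤ t := ht.1
      have h2 : t ≤ 1 / 3 := ht.2
      rcases h1.eq_or_lt with h | h
      · exact Or.inr (by simpa using h.symm)
      · exact Or.inl ⟨h, by linarith⟩
    · have h1 : 2 / 3 ≤ t := ht.1
      have h2 : t ≤ 1 := ht.2
      rcases h2.eq_or_lt with h | h
      · exact Or.inr (by simpa using h)
      · exact Or.inl ⟨by linarith, h⟩
  set p : A → Bool → ℝ × ℝ := fun a i => γ a (if i then 1 else 0) with hp
  have hdisjP : ∀ a i b j, p a i ≠ p b j → Disjoint (γ a '' I i) (γ b '' I j) := by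
    intro a i b j hne
    rw [Set.disjoint_left]
    rintro _ ⟨s, hs, rfl⟩ ⟨t, ht, hst⟩
    by_cases hab : a = b
    · subst hab
      have h1 := hi a (hI01 j ht) (hI01 i hs) hst
      subst h1
      refine hne ?_
      have hij : i = j := by
        cases i <;> cases j
        · rfl
        · have h1 : 2 / 3 ≤ t := ht.1
          have h2 : t ≤ 1 / 3 := hs.2
          linarith
        · have h1 : 2 / 3 ≤ t := hs.1
          have h2 : t ≤ 1 / 3 := ht.2
          linarith
        · rfl
      rw [hij]
    · rcases hIo i s hs with h | rfl
      · exact hd a b hab s h t (hI01 j ht) hst.symm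
      rcases hIo j t ht with h' | rfl
      · exact hd b a (Ne.symm hab) t h' _ (hI01 i hs) hst
      exact hne hst.symm
  have hcptP : ∀ a i, IsCompact (γ a '' I i) := fun a i =>
    (hIcpt i).image_of_continuousOn ((hc a).mono (hI01 i))
  have hcptM : ∀ a, IsCompact (γ a '' J) := fun a =>
    isCompact_Icc.image_of_continuousOn ((hc a).mono hJ01)
  set K : A × Option Bool → Set (ℝ × ℝ) := fun x => γ x.1 '' (x.2.elim J I) with hK
  have hKc : ∀ x, IsCompact (K x) := by
    rintro ⟨a, _ | i⟩
    · exact hcptM a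
    · exact hcptP a i
  obtain ⟨N, hN0, hN⟩ := exists_pos_forall_le_dist
    (fun x : (A × Option Bool) × (A × Option Bool) => K x.1) (fun x => K x.2)
    (fun x => hKc x.1) (fun x => hKc x.2)
  have hcont : Continuous fun x : ℝ × ℝ => N • x := continuous_const_smul N
  have hinj : Function.Injective fun x : ℝ × ℝ => N • x := smul_right_injective _ hN0.ne'
  obtain ⟨σ, hσ, hσp⟩ := exists_mapPlanar_of_separated
    (fun a i => (fun x : ℝ × ℝ => N • x) '' (γ a '' I i))
    (fun a => (fun x : ℝ × ℝ => N • x) '' (γ a '' J)) (fun a i => N • p a i)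
    (fun a i => ((hIpc i).image _ ((hc a).mono (hI01 i))).image _ hcont.continuousOn)
    (fun a => (isPreconnected_Icc.image _ ((hc a).mono hJ01)).image _ hcont.continuousOn)
    (fun a i => ((hcptP a i).image hcont).isBounded)
    (fun a => ((hcptM a).image hcont).isBounded)
    (fun a i => ⟨_, ⟨_, hIend i, rfl⟩, rfl⟩)
    (fun a i => by
      obtain ⟨t, h1, h2⟩ := hIJ i
      exact ⟨_, ⟨_, ⟨t, h1, rfl⟩, rfl⟩, ⟨_, ⟨t, h2, rfl⟩, rfl⟩⟩)
    (fun a h => by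
      have := hi a (by simp) (by simp) (hinj h)
      simp at this)
    (by
      rintro a i b j hne _ ⟨x, hx, rfl⟩ _ ⟨y, hy, rfl⟩
      exact hN ((a, some i), (b, some j)) (hdisjP a i b j fun h => hne (by rw [h])) x hx y hy)
    (by
      rintro a b hne _ ⟨x, hx, rfl⟩ _ ⟨y, hy, rfl⟩
      refine hN ((a, none), (b, none)) ?_ x hx y hy
      rw [Set.disjoint_left]
      rintro _ ⟨s, hs, rfl⟩ ⟨t, ht, hst⟩
      exact hd a b hne s (hJo hs) t (hJ01 ht) hst.symm)
    (by
      rintro a b j hne _ ⟨x, hx, rfl⟩ _ ⟨y, hy, rfl⟩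
      refine hN ((a, none), (b, some j)) ?_ x hx y hy
      rw [Set.disjoint_left]
      rintro _ ⟨s, hs, rfl⟩ ⟨t, ht, hst⟩
      exact hd a b hne s (hJo hs) t (hI01 j ht) hst.symm)
  refine ⟨σ, fun x y => ?_, hσp⟩
  rw [hσ]
  exact hinj.eq_iff

end Arcs

section Drawing

variable {V : Type*} {G : SimpleGraph V}

/-- The edge of a dart, as an element of the edge set. -/
def dartEdge (d : G.Dart) : G.edgeSet := ⟨d.edge, d.edge_mem⟩

theorem dartEdge_symm (d : G.Dart) : dartEdge d.symm = dartEdge d :=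
  Subtype.ext d.edge_symm

theorem dartEdge_eq_iff {d d' : G.Dart} : dartEdge d = dartEdge d' ↔ d = d' ∨ d = d'.symm := by
  rw [dartEdge, dartEdge, Subtype.mk.injEq, SimpleGraph.dart_edge_eq_iff]

theorem exists_dart_arc (Γ : OnePlanarDrawing G) (d : G.Dart) : ∃ β : ℝ → ℝ × ℝ,
    (β = Γ.arc (dartEdge d) ∨ β = fun t => Γ.arc (dartEdge d) (1 - t)) ∧
      β 0 = Γ.pos d.fst ∧ β 1 = Γ.pos d.snd := by
  obtain ⟨u, v, he, h0, h1⟩ := Γ.arc_ends (dartEdge d)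
  have he' : s(d.fst, d.snd) = s(u, v) := he
  rw [Sym2.eq_iff] at he'
  rcases he' with ⟨rfl, rfl⟩ | ⟨rfl, rfl⟩
  · exact ⟨_, Or.inl rfl, h0, h1⟩
  · exact ⟨_, Or.inr rfl, by simpa using h1, by simpa using h0⟩

theorem exists_crossing_point (Γ : OnePlanarDrawing G) (e : G.edgeSet) :
    ∃ q ∈ Γ.arc e '' Set.Ioo 0 1,
    ∀ f, f ≠ e → ∀ q' ∈ Γ.arc e '' Set.Ioo 0 1, q' ∈ Γ.arc f '' Set.Ioo 0 1 → q' = q := by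
  by_cases h : ∃ f, f ≠ e ∧ (Γ.arc e '' Set.Ioo 0 1 ∩ Γ.arc f '' Set.Ioo 0 1).Nonempty
  · obtain ⟨f, hf, q, hq⟩ := h
    refine ⟨q, hq.1, fun f' hf' q' h1 h2 => ?_⟩
    have hff : f' = f := Γ.at_most_one_crossing e ⟨hf', q', h1, h2⟩ ⟨hf, q, hq⟩
    subst hff
    exact Γ.crossings_subsingleton e f' hf.symm ⟨h1, h2⟩ hq
  · exact ⟨_, ⟨1 / 2, by norm_num, rfl⟩, fun f hf q' h1 h2 => absurd ⟨f, hf, q', h1, h2⟩ h⟩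

theorem sameCycle_iff_of_semiconj {D D' : Type*} [Finite D] {σ : Perm D} {τ : Perm D'} {ι : D' → D}
    (hι : Function.Injective ι) (h : ∀ x, σ (ι x) = ι (τ x)) (x y : D') :
    τ.SameCycle x y ↔ σ.SameCycle (ι x) (ι y) := by
  constructor
  · refine fun hxy => rel_of_sameCycle ((Perm.SameCycle.setoid σ).comap ι) (fun x => ?_) hxy
    change σ.SameCycle (ι x) (ι (τ x))
    rw [← h]
    exact sameCycle_self_apply _ _
  · intro hxy
    obtain ⟨n, hn⟩ := hxy.exists_nat_pow_eq
    refine ⟨(n : ℤ), ?_⟩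
    have key : ∀ n : ℕ, (σ ^ n) (ι x) = ι ((τ ^ n) x) := by
      intro n
      induction n with
      | zero => rfl
      | succ n ih => rw [pow_succ', Perm.mul_apply, ih, h, pow_succ', Perm.mul_apply]
    rw [zpow_natCast]
    exact hι (by rw [← key, hn])

variable [Fintype V] [DecidableRel G.Adj]

/-- The planar hypermap of a drawing, whose hyperedges are the classes of edges sharing a
crossing point. -/
theorem exists_hypermap (Γ : OnePlanarDrawing G) : ∃ ρ κ : Perm G.Dart,
    (∀ d d', ρ.SameCycle d d' ↔ d.fst = d'.fst) ∧
    (∀ d, κ.SameCycle d d.symm) ∧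
    (∀ d d' d'', κ.SameCycle d d' → κ.SameCycle d d'' → dartEdge d' ≠ dartEdge d →
      dartEdge d'' ≠ dartEdge d → dartEdge d' = dartEdge d'') ∧
    ∀ z : G.Dart → ZMod 2, (∀ d, cycleSum ρ z d = 0) → (∀ d, cycleSum κ z d = 0) →
      ∃ c : G.Dart → ZMod 2, (∀ d, c (ρ d) = c d + z d) ∧ ∀ d, c (κ d) + z (κ d) = c d := by
  classical
  choose β hβ hβ0 hβ1 using exists_dart_arc Γ
  choose X hX hXu using exists_crossing_point Γ
  have hX' : ∀ {e f} {q}, f ≠ e → q ∈ Γ.arc e '' Set.Ioo 0 1 → q ∈ Γ.arc f '' Set.Ioo 0 1 →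
      q = X e := fun {e f q} h h1 h2 => hXu e f h q h1 h2
  have hβo : ∀ d t, t ∈ Set.Ioo (0 : ℝ) 1 → β d t ∈ Γ.arc (dartEdge d) '' Set.Ioo 0 1 := by
    intro d t ht
    rcases hβ d with h | h <;> rw [h]
    · exact ⟨t, ht, rfl⟩
    · exact ⟨1 - t, ⟨by linarith [ht.2], by linarith [ht.1]⟩, rfl⟩
  have hβinj : ∀ d, Set.InjOn (β d) (Set.Icc 0 1) := by
    intro d
    rcases hβ d with h | h <;> rw [h]
    · exact Γ.arc_inj _
    · intro s hs t ht hst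
      have := Γ.arc_inj (dartEdge d)
        (⟨by linarith [hs.2], by linarith [hs.1]⟩ : 1 - s ∈ Set.Icc 0 1)
        (⟨by linarith [ht.2], by linarith [ht.1]⟩ : 1 - t ∈ Set.Icc 0 1) hst
      linarith
  have hβcont : ∀ d, ContinuousOn (β d) (Set.Icc 0 1) := by
    intro d
    rcases hβ d with h | h <;> rw [h]
    · exact Γ.arc_cont _
    · exact (Γ.arc_cont _).comp (by fun_prop) fun t ht => ⟨by linarith [ht.2], by linarith [ht.1]⟩
  have hpos : ∀ d : G.Dart, Γ.pos d.fst ≠ Γ.pos d.snd := fun d h => d.fst_ne_snd (Γ.pos_inj h)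
  have hβsymm : ∀ d t, β d.symm t = β d (1 - t) := by
    intro d t
    have h0 := hβ0 d
    have h0' := hβ0 d.symm
    have h1' := hβ1 d.symm
    have hd := hβ d.symm
    rw [dartEdge_symm] at hd
    rcases hβ d with h | h <;> rcases hd with h' | h'
    · exfalso
      rw [h', ← h, h0] at h0'
      exact hpos d h0'
    · rw [h, h']
    · rw [h, h']
      simp
    · exfalso
      rw [h', ← h, h0] at h0'
      exact hpos d h0'
  have hm : ∀ d, ∃ m ∈ Set.Ioo (0 : ℝ) 1, β d m = X (dartEdge d) := by
    intro d
    obtain ⟨m, hm, h⟩ := hX (dartEdge d)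
    rcases hβ d with h' | h' <;> rw [h']
    · exact ⟨m, hm, h⟩
    · exact ⟨1 - m, ⟨by linarith [hm.2], by linarith [hm.1]⟩, by simpa using h⟩
  choose m hm hmX using hm
  have hmul : ∀ d, ∀ t ∈ Set.Icc (0 : ℝ) 1, t * m d ∈ Set.Icc (0 : ℝ) 1 := fun d t ht =>
    ⟨mul_nonneg ht.1 (hm d).1.le, mul_le_one₀ ht.2 (hm d).1.le (hm d).2.le⟩
  have hXX : ∀ d d' : G.Dart, X (dartEdge d) = X (dartEdge d') → dartEdge d' ≠ dartEdge d →
      (Γ.arc (dartEdge d) '' Set.Ioo 0 1 ∩ Γ.arc (dartEdge d') '' Set.Ioo 0 1).Nonempty :=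
    fun d d' h _ => ⟨_, hX _, h ▸ hX _⟩
  obtain ⟨σ, hσ, hσp⟩ := exists_mapPlanar_of_arcs (fun d t => β d (t * m d))
    (fun d => (hβcont d).comp (by fun_prop) (hmul d))
    (fun d s hs t ht hst =>
      mul_right_cancel₀ (hm d).1.ne' (hβinj d (hmul d s hs) (hmul d t ht) hst))
    (by
      intro a b hab s hs t ht hst
      have hs' : s * m a ∈ Set.Ioo (0 : ℝ) 1 :=
        ⟨mul_pos hs.1 (hm a).1, by nlinarith [hs.1, hs.2, (hm a).1, (hm a).2]⟩
      by_cases he : dartEdge b = dartEdge a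
      · rcases dartEdge_eq_iff.1 he with h | h
        · exact hab h.symm
        · subst h
          simp only [hβsymm] at hst
          have h1 : β a (1 - m a.symm) = β a (m a) := by
            rw [← hβsymm, hmX, hmX, dartEdge_symm]
          have h2 := (hm a.symm).1
          have h3 := (hm a.symm).2
          have h4 := hβinj a ⟨by linarith, by linarith⟩ ⟨(hm a).1.le, (hm a).2.le⟩ h1
          have h5 := hmul a.symm t ht
          have h6 := hβinj a ⟨hs'.1.le, hs'.2.le⟩ ⟨by linarith [h5.2], by linarith [h5.1]⟩ hst
          have h7 : s * m a < m a := by nlinarith [hs.2, (hm a).1]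
          have h8 : t * m a.symm ≤ m a.symm := by nlinarith [ht.2]
          linarith
      · rcases ht.1.eq_or_lt with h | h
        · subst h
          simp only [zero_mul, hβ0] at hst
          obtain ⟨u, hu, hu'⟩ := hβo a _ hs'
          exact Γ.arc_avoids _ u hu ⟨_, (hu'.trans hst).symm⟩
        · have ht' : t * m b ∈ Set.Ioo (0 : ℝ) 1 :=
            ⟨mul_pos h (hm b).1, by nlinarith [ht.2, (hm b).1, (hm b).2]⟩
          have h1 := hX' he (hβo a _ hs') (hst ▸ hβo b _ ht')
          rw [← hmX] at h1
          have h2 := hβinj a ⟨hs'.1.le, hs'.2.le⟩ ⟨(hm a).1.le, (hm a).2.le⟩ h1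
          nlinarith [hs.2, (hm a).1])
  have hff : ∀ d d' : G.Dart, σ.SameCycle (d, false) (d', false) ↔ d.fst = d'.fst := by
    intro d d'
    rw [hσ]
    simp only [Bool.false_eq_true, if_false, zero_mul, hβ0]
    exact Γ.pos_inj.eq_iff
  have htt : ∀ d d' : G.Dart, σ.SameCycle (d, true) (d', true) ↔
      X (dartEdge d) = X (dartEdge d') := by
    intro d d'
    rw [hσ]
    simp only [if_true, one_mul, hmX]
  have hft : ∀ d d' : G.Dart, ¬ σ.SameCycle (d, false) (d', true) := by
    intro d d' h
    rw [hσ] at h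
    simp only [Bool.false_eq_true, if_true, if_false, one_mul, zero_mul, hmX, hβ0] at h
    obtain ⟨u, hu, hu'⟩ := hX (dartEdge d')
    exact Γ.arc_avoids _ u hu ⟨_, (hu'.trans h.symm).symm⟩
  have hpres : ∀ d i, σ (d, i) = ((σ (d, i)).1, i) := by
    intro d i
    have h := sameCycle_self_apply σ (d, i)
    generalize σ (d, i) = y at h
    obtain ⟨d', j⟩ := y
    cases i <;> cases j
    · rfl
    · exact absurd h (hft _ _)
    · exact absurd h.symm (hft _ _)
    · rfl
  have hperm : ∀ i : Bool, ∃ τ : Perm G.Dart, ∀ d, σ (d, i) = (τ d, i) := by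
    intro i
    refine ⟨Equiv.ofBijective (fun d => (σ (d, i)).1) (Finite.injective_iff_bijective.1 ?_),
      fun d => hpres d i⟩
    intro d d' h
    have h1 : σ (d, i) = σ (d', i) := by
      rw [hpres d i, hpres d' i]
      exact congrArg (fun x => (x, i)) h
    exact (Prod.mk.inj (σ.injective h1)).1
  have hinj : ∀ i : Bool, Function.Injective fun d : G.Dart => (d, i) :=
    fun i a b h => (Prod.mk.inj h).1
  obtain ⟨ρ, hρ⟩ := hperm false
  obtain ⟨κ, hκ⟩ := hperm true
  have hρc := sameCycle_iff_of_semiconj (hinj false) hρ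
  have hκc := sameCycle_iff_of_semiconj (hinj true) hκ
  have hκX : ∀ d d', κ.SameCycle d d' ↔ X (dartEdge d) = X (dartEdge d') := fun d d' =>
    (hκc d d').trans (htt d d')
  refine ⟨ρ, κ, fun d d' => (hρc d d').trans (hff d d'), fun d => ?_, ?_, ?_⟩
  · rw [hκX, dartEdge_symm]
  · intro d d' d'' h1 h2 h3 h4
    rw [hκX] at h1 h2
    exact Γ.at_most_one_crossing (dartEdge d) ⟨h3, hXX _ _ h1 h3⟩ ⟨h4, hXX _ _ h2 h4⟩
  · intro z h1 h2
    have hsum : ∀ (i : Bool) (τ : Perm G.Dart), (∀ d, σ (d, i) = (τ d, i)) → ∀ d,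
        cycleSum σ (fun x => z x.1) (d, i) = cycleSum τ z d := by
      intro i τ hτ d
      unfold cycleSum
      symm
      refine Finset.sum_bij (fun d _ => (d, i)) ?_ (fun a _ b _ h => hinj i h) ?_ fun _ _ => rfl
      · intro x hx
        simp only [Finset.mem_filter, Finset.mem_univ, true_and] at hx ⊢
        exact (sameCycle_iff_of_semiconj (hinj i) hτ d x).1 hx
      · rintro ⟨x, j⟩ hx
        simp only [Finset.mem_filter, Finset.mem_univ, true_and] at hx
        have hj : i = j := by
          cases i <;> cases j
          · rfl
          · exact absurd hx (hft _ _)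
          · exact absurd hx.symm (hft _ _)
          · rfl
        subst hj
        refine ⟨x, ?_, rfl⟩
        simp only [Finset.mem_filter, Finset.mem_univ, true_and]
        exact (sameCycle_iff_of_semiconj (hinj i) hτ d x).2 hx
    obtain ⟨c, hc1, hc2⟩ := hσp (fun x => z x.1) (fun _ => rfl) (fun _ h => absurd h id) (by
      rintro ⟨d, i⟩
      cases i
      · rw [hsum false ρ hρ, h1]
      · rw [hsum true κ hκ, h2])
    refine ⟨fun d => c (d, false), fun d => ?_, fun d => ?_⟩
    · have := hc1 (d, false)
      rwa [hρ] at this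
    · have e1 := hc1 (d, true)
      have e2 := hc2 (d, false)
      have e3 := hc2 (κ d, false)
      rw [hκ] at e1
      simp only [Bool.not_false] at e1 e2 e3
      have e4 := zmod_two_add_self (z d)
      linear_combination e1 + e2 - e3 + e4

end Drawing

section CrossingMaps

variable {V : Type*}

/-- A combinatorial drawing of `G`: `rot` is the rotation of the darts around their base points,
and `cross` sends a dart to the next dart pointing to the same crossing point, or to its reversal
if its edge is not crossed. -/
structure CrossingMap (G : SimpleGraph V) where
  rot : Perm G.Dart
  cross : Perm G.Dart
  rot_sameCycle : ∀ d d', rot.SameCycle d d' ↔ d.fst = d'.fst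
  cross_symm : ∀ d, cross d.symm = (cross d).symm
  cross_cases : ∀ d, cross d = d.symm ∨ cross (cross d) = d.symm

variable {G : SimpleGraph V} (R : CrossingMap G)

namespace CrossingMap

/-- The edge of the dart `d` is not crossed. -/
def Free (d : G.Dart) : Prop := R.cross d = d.symm

/-- Homological planarity of a combinatorial drawing. -/
def Planar [Fintype V] [DecidableRel G.Adj] : Prop :=
  ∀ z : G.Dart → ZMod 2, (∀ d, R.Free d → z d = z d.symm) →
    (∀ d, ¬ R.Free d → z d + z (R.cross d) + z d.symm + z (R.cross d).symm = 0) →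
    (∀ d, cycleSum R.rot z d = 0) →
    ∃ c : G.Dart → ZMod 2, (∀ d, c (R.rot d) = c d + z d) ∧
      ∀ d, c (R.cross d) + z (R.cross d) = c d

end CrossingMap

theorem cycleSum_eq_sum {D : Type*} [Fintype D] (σ : Perm D) (z : D → ZMod 2) (d : D)
    (s : Finset D) (hs : ∀ x, σ.SameCycle d x ↔ x ∈ s) : cycleSum σ z d = ∑ x ∈ s, z x := by
  unfold cycleSum
  exact Finset.sum_congr (by ext; simp [hs]) fun _ _ => rfl

theorem dart_symm_ne (d : G.Dart) : d.symm ≠ d := SimpleGraph.Dart.symm_ne d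

theorem bijective_of_cross_cases {τ : G.Dart → G.Dart} (hs : ∀ d, τ d.symm = (τ d).symm)
    (h : ∀ d, τ d = d.symm ∨ τ (τ d) = d.symm) : Function.Bijective τ := by
  have h4 : ∀ d, τ (τ (τ (τ d))) = d := by
    intro d
    rcases h d with h | h
    · simp only [h, hs, SimpleGraph.Dart.symm_symm]
    · rw [h, hs, hs, h, SimpleGraph.Dart.symm_symm]
  exact ⟨fun a b hab => by rw [← h4 a, ← h4 b, hab], fun a => ⟨_, h4 a⟩⟩

theorem exists_planar_crossingMap [Fintype V] [DecidableRel G.Adj] (h : G.IsOnePlanar) :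
    ∃ R : CrossingMap G, R.Planar := by
  classical
  obtain ⟨Γ⟩ := h
  obtain ⟨ρ, κ, hρ, hκs, hκu, hp⟩ := exists_hypermap Γ
  have hss : ∀ d : G.Dart, d.symm.symm = d := SimpleGraph.Dart.symm_symm
  have hedge : ∀ {d g : G.Dart}, dartEdge g ≠ dartEdge d → g ≠ d ∧ g ≠ d.symm := fun {d g} h =>
    ⟨fun h' => h (dartEdge_eq_iff.2 (Or.inl h')), fun h' => h (dartEdge_eq_iff.2 (Or.inr h'))⟩
  have hfix : ∀ d, κ d ≠ d := fun d hd => by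
    obtain ⟨i, hi⟩ := hκs d
    rw [Perm.zpow_apply_eq_self_of_apply_eq_self hd] at hi
    exact dart_symm_ne d hi.symm
  set W : G.Dart → Prop := fun d => κ d = d.symm ∨ κ d.symm = d with hW
  have hWs : ∀ d, W d.symm ↔ W d := fun d => by simp only [hW, hss]; exact or_comm
  have hother : ∀ d, ¬ W d → dartEdge (κ d) ≠ dartEdge d := fun d hd h => by
    rcases dartEdge_eq_iff.1 h with h | h
    · exact hfix d h
    · exact hd (Or.inl h)
  have hclass : ∀ d g, κ.SameCycle d g → dartEdge g ≠ dartEdge d → ∀ x, κ.SameCycle d x →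
      x = d ∨ x = d.symm ∨ x = g ∨ x = g.symm := fun d g hg hdg x hx => by
    by_cases h : dartEdge x = dartEdge d
    · rcases dartEdge_eq_iff.1 h with h | h
      · exact Or.inl h
      · exact Or.inr (Or.inl h)
    · rcases dartEdge_eq_iff.1 (hκu d x g hx hg h hdg) with h | h
      · exact Or.inr (Or.inr (Or.inl h))
      · exact Or.inr (Or.inr (Or.inr h))
  have halt : ∀ d, ¬ W d → κ d.symm = (κ d).symm ∧ κ (κ d) = d.symm ∧ κ (κ d).symm = d := by
    intro d hd
    have h1 := sameCycle_self_apply κ d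
    have hcl := hclass d (κ d) h1 (hother d hd)
    have hne := hedge (hother d hd)
    have e1 : κ d.symm = (κ d).symm := by
      rcases hcl _ ((hκs d).trans (sameCycle_self_apply κ _)) with h | h | h | h
      · exact absurd (Or.inr h) hd
      · exact absurd h (hfix _)
      · exact absurd (κ.injective h) (dart_symm_ne d)
      · exact h
    have e2 : κ (κ d) = d.symm := by
      rcases hcl _ (h1.trans (sameCycle_self_apply κ _)) with h | h | h | h
      · exfalso
        have h2 : d.symm = d ∨ d.symm = κ d := rel_of_sameCycle (σ := κ)
          (Setoid.ker fun x => x = d ∨ x = κ d) (fun x => propext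
            ⟨fun hx => hx.elim (fun hx => Or.inr (hx ▸ rfl)) (fun hx => Or.inl (hx ▸ h)),
              fun hx => hx.elim (fun hx => Or.inr (κ.injective (hx.trans h.symm)))
                (fun hx => Or.inl (κ.injective hx))⟩) (hκs d) |>.mp (Or.inl rfl)
        rcases h2 with h2 | h2
        · exact dart_symm_ne d h2
        · exact hne.2 h2.symm
      · exact h
      · exact absurd h (hfix _)
      · rw [← e1] at h
        exact absurd (κ.injective h) hne.2
    refine ⟨e1, e2, ?_⟩
    rcases hcl _ ((h1.trans (hκs _)).trans (sameCycle_self_apply κ _)) with h | h | h | h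
    · exact h
    · rw [← e2] at h
      exact absurd (κ.injective h) (dart_symm_ne _)
    · have := κ.injective h
      exact absurd (by rw [← congrArg SimpleGraph.Dart.symm this, hss]) hne.2
    · exact absurd h (hfix _)
  have hWκ : ∀ d, ¬ W d → ¬ W (κ d) := by
    intro d hd
    obtain ⟨h1, h2, h3⟩ := halt d hd
    have hne := hedge (hother d hd)
    rintro (h | h)
    · rw [h2] at h
      have := congrArg SimpleGraph.Dart.symm h
      rw [hss, hss] at this
      exact hne.1 this.symm
    · rw [h3] at h
      exact hne.1 h.symm
  set τ : G.Dart → G.Dart := fun d => if W d then d.symm else κ d with hτ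
  have hτW : ∀ d, W d → τ d = d.symm := fun d h => if_pos h
  have hτN : ∀ d, ¬ W d → τ d = κ d := fun d h => if_neg h
  have hτs : ∀ d, τ d.symm = (τ d).symm := by
    intro d
    by_cases h : W d
    · rw [hτW d h, hτW _ ((hWs d).2 h)]
    · rw [hτN d h, hτN _ (fun h' => h ((hWs d).1 h')), (halt d h).1]
  have hτ2 : ∀ d, τ d = d.symm ∨ τ (τ d) = d.symm := by
    intro d
    by_cases h : W d
    · exact Or.inl (hτW d h)
    · right
      rw [hτN d h, hτN _ (hWκ d h), (halt d h).2.1]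
  refine ⟨⟨ρ, Equiv.ofBijective τ (bijective_of_cross_cases hτs hτ2), hρ, hτs, hτ2⟩, ?_⟩
  intro z hz1 hz2 hz3
  have hfree : ∀ d, W d → z d = z d.symm := fun d h => hz1 d (hτW d h)
  have hcr : ∀ d, ¬ W d → z d + z (κ d) + z d.symm + z (κ d).symm = 0 := fun d h => by
    have h1 := hz2 d fun h' => h (Or.inl ((hτN d h).symm.trans h'))
    change z d + z (τ d) + z d.symm + z (τ d).symm = 0 at h1
    rwa [hτN d h] at h1
  obtain ⟨c, hc1, hc2⟩ := hp z hz3 (fun d => by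
    by_cases hg : ∃ g, κ.SameCycle d g ∧ dartEdge g ≠ dartEdge d
    · obtain ⟨g, hg, hdg⟩ := hg
      have hne := hedge hdg
      have hne' := hedge hdg.symm
      have hset : ∀ x, κ.SameCycle d x ↔ x ∈ ({d, d.symm, g, g.symm} : Finset G.Dart) := by
        intro x
        simp only [Finset.mem_insert, Finset.mem_singleton]
        refine ⟨hclass d g hg hdg x, ?_⟩
        rintro (rfl | rfl | rfl | rfl)
        · exact Perm.SameCycle.refl _ _
        · exact hκs _
        · exact hg
        · exact hg.trans (hκs _)
      have hsum : cycleSum κ z d = z d + z d.symm + z g + z g.symm := by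
        rw [cycleSum_eq_sum _ _ _ _ hset, Finset.sum_insert, Finset.sum_insert, Finset.sum_insert,
          Finset.sum_singleton]
        · ring
        · simpa using (dart_symm_ne g).symm
        · simp only [Finset.mem_insert, Finset.mem_singleton, not_or]
          refine ⟨hne.2.symm, fun h => hne.1 ?_⟩
          rw [← hss g, ← h, hss]
        · simp only [Finset.mem_insert, Finset.mem_singleton, not_or]
          exact ⟨(dart_symm_ne d).symm, hne.1.symm, hne'.2⟩
      rw [hsum]
      by_cases hd : W d
      · by_cases hgW : W g
        · rw [hfree d hd, hfree g hgW]
          have e1 := zmod_two_add_self (z d.symm)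
          have e2 := zmod_two_add_self (z g.symm)
          linear_combination e1 + e2
        · have h1 := hcr g hgW
          rcases hclass g d hg.symm hdg.symm _ (sameCycle_self_apply κ g) with h | h | h | h
          · exact absurd h (hfix g)
          · exact absurd (Or.inl h) hgW
          · rw [h] at h1
            linear_combination h1
          · rw [h, hss] at h1
            linear_combination h1
      · have h1 := hcr d hd
        rcases hclass d g hg hdg _ (sameCycle_self_apply κ d) with h | h | h | h
        · exact absurd h (hfix d)
        · exact absurd (Or.inl h) hd
        · rw [h] at h1
          linear_combination h1
        · rw [h, hss] at h1
          linear_combination h1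
    · have hset : ∀ x, κ.SameCycle d x ↔ x ∈ ({d, d.symm} : Finset G.Dart) := by
        intro x
        simp only [Finset.mem_insert, Finset.mem_singleton]
        refine ⟨fun hx => ?_, ?_⟩
        · by_contra h
          exact hg ⟨x, hx, fun h' => h (dartEdge_eq_iff.1 h')⟩
        · rintro (rfl | rfl)
          · exact Perm.SameCycle.refl _ _
          · exact hκs _
      rw [cycleSum_eq_sum _ _ _ _ hset, Finset.sum_pair (dart_symm_ne d).symm]
      have hd : W d := by
        by_contra h
        exact hg ⟨κ d, sameCycle_self_apply κ d, hother d h⟩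
      rw [hfree d hd]
      exact zmod_two_add_self _)
  refine ⟨c, hc1, fun d => ?_⟩
  change c (τ d) + z (τ d) = c d
  by_cases h : W d
  · rw [hτW d h]
    have h1 := hc2 d
    have h2 := hc2 d.symm
    have h3 := hfree d h
    rcases h with h | h
    · rwa [h] at h1
    · rw [h] at h2
      have e := zmod_two_add_self (z d.symm)
      linear_combination -h2 + h3 + e
  · rw [hτN d h]
    exact hc2 d

end CrossingMaps

section Uncrossing

variable {V : Type*} {G : SimpleGraph V}

theorem dart_symm_symm (d : G.Dart) : d.symm.symm = d := SimpleGraph.Dart.symm_symm d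

namespace CrossingMap

theorem free_symm (R : CrossingMap G) (d : G.Dart) : R.Free d.symm ↔ R.Free d := by
  unfold Free
  rw [R.cross_symm]
  exact SimpleGraph.Dart.symm_involutive.injective.eq_iff

theorem cross_cross_of_not_free (R : CrossingMap G) {d : G.Dart} (h : ¬ R.Free d) :
    R.cross (R.cross d) = d.symm :=
  (R.cross_cases d).resolve_left h

theorem free_cross (R : CrossingMap G) (d : G.Dart) : R.Free (R.cross d) ↔ R.Free d := by
  constructor
  · intro h
    rcases R.cross_cases d with h' | h'
    · exact h'
    · rw [h] at h'
      have h3 := congrArg SimpleGraph.Dart.symm h'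
      rw [dart_symm_symm, dart_symm_symm] at h3
      rwa [h3] at h
  · intro h
    have h' : R.cross d = d.symm := h
    rw [h']
    exact (R.free_symm d).2 h

theorem exists_uncrossing [Fintype V] [DecidableRel G.Adj] (R : CrossingMap G) (hR : R.Planar)
    {p : G.Dart} (hp : ¬ R.Free p) (hfst : (R.cross p).fst = p.fst) :
    ∃ R' : CrossingMap G, R'.Planar ∧ (∀ d, R.Free d → R'.Free d) ∧ R'.Free p := by
  classical
  have hss : ∀ d : G.Dart, d.symm.symm = d := SimpleGraph.Dart.symm_symm
  obtain ⟨q, hq⟩ : ∃ q, R.cross p = q := ⟨_, rfl⟩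
  have hq1 : R.cross q = p.symm := hq ▸ R.cross_cross_of_not_free hp
  have hq2 : R.cross p.symm = q.symm := by rw [R.cross_symm, hq]
  have hq3 : R.cross q.symm = p := by rw [R.cross_symm, hq1, hss]
  rw [hq] at hfst
  have hqps : q ≠ p.symm := fun h => hp (hq.trans h)
  have hpqs : p ≠ q.symm := fun h => hqps (by rw [h, hss])
  set s : Perm G.Dart := swap p q with hs
  have sp : s p = q := swap_apply_left _ _
  have sq : s q = p := swap_apply_right _ _
  have sps : s p.symm = p.symm := swap_apply_of_ne_of_ne (dart_symm_ne p) hqps.symm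
  have sqs : s q.symm = q.symm := swap_apply_of_ne_of_ne hpqs.symm (dart_symm_ne q)
  have ssx : ∀ d, s (s d) = d := fun d => swap_apply_self _ _ _
  have hsfst : ∀ d, (s d).fst = d.fst := by
    intro d
    by_cases h1 : d = p
    · rw [h1, sp, hfst]
    by_cases h2 : d = q
    · rw [h2, sq, hfst]
    rw [hs, swap_apply_of_ne_of_ne h1 h2]
  set S : G.Dart → Prop := fun d => d = p ∨ d = q ∨ d = p.symm ∨ d = q.symm with hS
  have hSs : ∀ d, S d.symm ↔ S d := by
    have h : ∀ d, S d → S d.symm := by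
      rintro d (rfl | rfl | rfl | rfl)
      · exact Or.inr (Or.inr (Or.inl rfl))
      · exact Or.inr (Or.inr (Or.inr rfl))
      · exact Or.inl (hss _)
      · exact Or.inr (Or.inl (hss _))
    exact fun d => ⟨fun h' => hss d ▸ h _ h', h d⟩
  have hSc : ∀ d, S (R.cross d) ↔ S d := by
    intro d
    constructor
    · rintro (h | h | h | h)
      · exact Or.inr (Or.inr (Or.inr (R.cross.injective (h.trans hq3.symm))))
      · exact Or.inl (R.cross.injective (h.trans hq.symm))
      · exact Or.inr (Or.inl (R.cross.injective (h.trans hq1.symm)))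
      · exact Or.inr (Or.inr (Or.inl (R.cross.injective (h.trans hq2.symm))))
    · rintro (rfl | rfl | rfl | rfl)
      · exact Or.inr (Or.inl hq)
      · exact Or.inr (Or.inr (Or.inl hq1))
      · exact Or.inr (Or.inr (Or.inr hq2))
      · exact Or.inl hq3
  have hsS : ∀ d, ¬ S d → s d = d := fun d h =>
    swap_apply_of_ne_of_ne (fun h' => h (Or.inl h')) fun h' => h (Or.inr (Or.inl h'))
  set f : G.Dart → G.Dart := fun d => if S d then d.symm else R.cross d with hf
  have hfS : ∀ d, S d → f d = d.symm := fun d h => if_pos h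
  have hfN : ∀ d, ¬ S d → f d = R.cross d := fun d h => if_neg h
  have hfs : ∀ d, f d.symm = (f d).symm := by
    intro d
    by_cases h : S d
    · rw [hfS d h, hfS _ ((hSs d).2 h)]
    · rw [hfN d h, hfN _ (fun h' => h ((hSs d).1 h')), R.cross_symm]
  have hf2 : ∀ d, f d = d.symm ∨ f (f d) = d.symm := by
    intro d
    by_cases h : S d
    · exact Or.inl (hfS d h)
    · rw [hfN d h, hfN _ (fun h' => h ((hSc d).1 h'))]
      exact R.cross_cases d
  have hrot : ∀ d d', (s * R.rot * s).SameCycle d d' ↔ d.fst = d'.fst := by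
    intro d d'
    have h : s * R.rot * s = s * R.rot * s⁻¹ := by rw [hs, swap_inv]
    rw [h, Perm.sameCycle_conj, R.rot_sameCycle, hs, swap_inv, ← hs, hsfst, hsfst]
  refine ⟨⟨s * R.rot * s, Equiv.ofBijective f (bijective_of_cross_cases hfs hf2), hrot, hfs, hf2⟩,
    ?_, ?_, ?_⟩
  · intro z hz1 hz2 hz3
    have hfree : ∀ d, S d → z d = z d.symm := fun d h => hz1 d (hfS d h)
    have hzp := hfree p (Or.inl rfl)
    have hzq := hfree q (Or.inr (Or.inl rfl))
    have e1 := zmod_two_add_self (z p.symm)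
    have e2 := zmod_two_add_self (z q.symm)
    refine (hR (fun d => z (s d)) ?_ ?_ ?_).elim ?_
    · intro d hd
      have h : ¬ S d := by
        rintro (rfl | rfl | rfl | rfl)
        · exact hp hd
        · exact hp ((R.free_cross p).1 (hq ▸ hd))
        · exact hp ((R.free_symm p).1 hd)
        · exact hp ((R.free_cross p).1 (hq ▸ (R.free_symm _).1 hd))
      simp only [hsS d h, hsS _ (fun h' => h ((hSs d).1 h'))]
      exact hz1 d ((hfN d h).trans hd)
    · intro d hd
      by_cases h : S d
      · rcases h with rfl | rfl | rfl | rfl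
        · simp only [hq, sp, sq, sps, sqs]
          linear_combination hzp + hzq + e1 + e2
        · simp only [hq1, sp, sq, sps, sqs, hss]
          linear_combination hzp + hzq + e1 + e2
        · simp only [hq2, sp, sq, sps, sqs, hss]
          linear_combination hzp + hzq + e1 + e2
        · simp only [hq3, sp, sq, sps, sqs, hss]
          linear_combination hzp + hzq + e1 + e2
      · have h' : ¬ S (R.cross d) := fun h' => h ((hSc d).1 h')
        simp only [hsS d h, hsS _ h', hsS _ (fun g => h ((hSs d).1 g)),
          hsS _ (fun g => h' ((hSs _).1 g))]
        have := hz2 d fun g => hd ((hfN d h).symm.trans g)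
        change z d + z (f d) + z d.symm + z (f d).symm = 0 at this
        rwa [hfN d h] at this
    · intro d
      have h1 := hz3 d
      rw [cycleSum_eq_sum _ _ _ ({x | d.fst = x.fst} : Finset G.Dart)
        (fun x => by rw [R.rot_sameCycle]; simp)]
      rw [cycleSum_eq_sum _ _ _ ({x | d.fst = x.fst} : Finset G.Dart)
        (fun x => (hrot d x).trans (by simp))] at h1
      rw [← h1]
      exact Finset.sum_equiv s (by simp [hsfst]) (by simp)
    · rintro c ⟨hc1, hc2⟩
      refine ⟨fun d => c (s d), fun d => ?_, fun d => ?_⟩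
      · have := hc1 (s d)
        rw [ssx] at this
        simp only [Perm.mul_apply, ssx]
        exact this
      · change c (s (f d)) + z (f d) = c (s d)
        have g1 := hc2 p
        have g2 := hc2 q
        have g3 := hc2 p.symm
        have g4 := hc2 q.symm
        simp only [hq, hq1, hq2, hq3, sp, sq, sps, sqs] at g1 g2 g3 g4
        by_cases h : S d
        · rw [hfS d h]
          rcases h with rfl | rfl | rfl | rfl
          · rw [sps, sp]
            exact g2
          · rw [sqs, sq]
            linear_combination -g4 + hzq + e2
          · rw [hss, sps, sp]
            linear_combination -g2 + hzp + e1
          · rw [hss, sqs, sq]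
            exact g4
        · have h' : ¬ S (R.cross d) := fun h' => h ((hSc d).1 h')
          have := hc2 d
          simp only [hsS _ h'] at this
          rw [hfN d h, hsS d h, hsS _ h']
          exact this
  · intro d hd
    change f d = d.symm
    by_cases h : S d
    · exact hfS d h
    · exact (hfN d h).trans hd
  · exact hfS p (Or.inl rfl)

/-- No two edges with a common end cross. -/
def NoAdjacentCrossing (R : CrossingMap G) : Prop :=
  ∀ d, ¬ R.Free d → (R.cross d).fst ≠ d.fst

end CrossingMap

theorem exists_planar_noAdjacentCrossing [Fintype V] [DecidableRel G.Adj] (h : G.IsOnePlanar) :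
    ∃ R : CrossingMap G, R.Planar ∧ R.NoAdjacentCrossing := by
  classical
  obtain ⟨R, hR⟩ := exists_planar_crossingMap h
  suffices H : ∀ n, ∀ R : CrossingMap G, R.Planar →
      (Finset.univ.filter fun d => ¬ R.Free d).card = n →
      ∃ R : CrossingMap G, R.Planar ∧ R.NoAdjacentCrossing from H _ R hR rfl
  intro n
  induction n using Nat.strong_induction_on with
  | _ n ih =>
    intro R hR hn
    by_cases hc : R.NoAdjacentCrossing
    · exact ⟨R, hR, hc⟩
    · unfold CrossingMap.NoAdjacentCrossing at hc
      push Not at hc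
      obtain ⟨p, hp, hfst⟩ := hc
      obtain ⟨R', hR', hsub, hp'⟩ := R.exists_uncrossing hR hp hfst
      refine ih _ (hn ▸ Finset.card_lt_card ?_) R' hR' rfl
      rw [Finset.ssubset_iff_of_subset]
      · exact ⟨p, by simpa using hp, by simpa using hp'⟩
      · intro d
        simpa using mt (hsub d)

end Uncrossing

section EulerInequality

variable {D : Type*}

/-- The type of cycles of a permutation. -/
abbrev Cycles (σ : Perm D) : Type _ := Quotient (Perm.SameCycle.setoid σ)

theorem card_add_two_le_card_cycles [Fintype D] [Nonempty D] (ρ κ : Perm D)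
    (h : ∀ z : D → ZMod 2, (∀ d, cycleSum ρ z d = 0) → (∀ d, cycleSum κ z d = 0) →
      ∃ c : D → ZMod 2, (∀ d, c (ρ d) = c d + z d) ∧ ∀ d, c (κ d) + z (κ d) = c d) :
    Nat.card D + 2 ≤ Nat.card (Cycles ρ) + Nat.card (Cycles κ) + Nat.card (Cycles (ρ * κ)) := by
  classical
  have : ∀ σ : Perm D, Fintype (Cycles σ) := fun σ => Fintype.ofFinite _
  let S : ∀ σ : Perm D, (D → ZMod 2) →ₗ[ZMod 2] (Cycles σ → ZMod 2) := fun σ =>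
    { toFun := fun z q => ∑ d with (Quotient.mk _ d : Cycles σ) = q, z d
      map_add' := fun z z' => by ext q; simp [Finset.sum_add_distrib]
      map_smul' := fun a z => by ext q; simp [Finset.mul_sum] }
  have hS : ∀ σ : Perm D, ∀ z d, S σ z (Quotient.mk _ d) = cycleSum σ z d := fun σ z d =>
    (cycleSum_eq_sum σ z d _ fun x => by
      simp only [Finset.mem_filter, Finset.mem_univ, true_and]
      exact ⟨fun h => Quotient.sound h.symm, fun h => (Quotient.exact h).symm⟩).symm
  have hSsum : ∀ σ : Perm D, ∀ z, ∑ q, S σ z q = ∑ d, z d := fun σ z =>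
    Finset.sum_fiberwise _ _ _
  let L := (S ρ).prod (S κ)
  let T : ((Cycles ρ → ZMod 2) × (Cycles κ → ZMod 2)) →ₗ[ZMod 2] ZMod 2 :=
    { toFun := fun a => ∑ q, a.1 q - ∑ q, a.2 q
      map_add' := fun a b => by simp [Finset.sum_add_distrib]; ring
      map_smul' := fun a b => by simp [← Finset.mul_sum]; ring }
  have hLT : LinearMap.range L ≤ LinearMap.ker T := by
    rintro _ ⟨z, rfl⟩
    change ∑ q, S ρ z q - ∑ q, S κ z q = 0
    rw [hSsum, hSsum, sub_self]
  obtain ⟨d₀⟩ := ‹Nonempty D›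
  have hT : LinearMap.range T = ⊤ := by
    refine LinearMap.range_eq_top.2 fun a => ⟨(Pi.single (Quotient.mk _ d₀) a, 0), ?_⟩
    change ∑ q, Pi.single (M := fun _ => ZMod 2) _ a q - ∑ q : Cycles κ, (0 : ZMod 2) = a
    simp
  let N : (Cycles (ρ * κ) → ZMod 2) →ₗ[ZMod 2] (D → ZMod 2) :=
    { toFun := fun c d => c (Quotient.mk _ (ρ d)) - c (Quotient.mk _ d)
      map_add' := fun a b => by ext; simp; ring
      map_smul' := fun a b => by ext; simp; ring }
  have hLN : LinearMap.ker L ≤ LinearMap.range N := by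
    intro z hz
    have hz' : (S ρ z, S κ z) = 0 := hz
    rw [Prod.mk_eq_zero] at hz'
    obtain ⟨c, hc1, hc2⟩ := h z (fun d => by rw [← hS, hz'.1]; rfl)
      (fun d => by rw [← hS, hz'.2]; rfl)
    have hinv : ∀ x y, (ρ * κ).SameCycle x y → c x = c y := fun x y hxy =>
      rel_of_sameCycle (Setoid.ker c) (fun x => by
        change c x = c (ρ (κ x))
        rw [hc1, hc2]) hxy
    refine ⟨fun q => Quotient.lift c hinv q, ?_⟩
    ext d
    change c (ρ d) - c d = z d
    rw [hc1, add_sub_cancel_left]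
  have hN : LinearMap.ker N ≠ ⊥ := by
    intro hb
    have h1 : (fun _ => 1 : Cycles (ρ * κ) → ZMod 2) ∈ LinearMap.ker N := by
      ext d
      change (1 : ZMod 2) - 1 = 0
      simp
    rw [hb, Submodule.mem_bot] at h1
    exact one_ne_zero (congrFun h1 (Quotient.mk _ d₀))
  have e1 := LinearMap.finrank_range_add_finrank_ker L
  have e2 := LinearMap.finrank_range_add_finrank_ker T
  have e3 := LinearMap.finrank_range_add_finrank_ker N
  have e4 := Submodule.finrank_mono hLT
  have e5 := Submodule.finrank_mono hLN
  have e6 := Submodule.one_le_finrank_iff.2 hN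
  rw [hT, finrank_top] at e2
  simp only [Module.finrank_prod, Module.finrank_pi, Module.finrank_self] at e1 e2 e3
  simp only [Nat.card_eq_fintype_card]
  omega

theorem mul_card_cycles_le [Fintype D] (σ : Perm D) (u : D → ℕ) (n : ℕ)
    (h : ∀ d, ∃ s : Finset D, (∀ x ∈ s, σ.SameCycle d x) ∧ n ≤ ∑ x ∈ s, u x) :
    n * Nat.card (Cycles σ) ≤ ∑ d, u d := by
  classical
  have : Fintype (Cycles σ) := Fintype.ofFinite _
  rw [← Finset.sum_fiberwise Finset.univ (fun d => (Quotient.mk _ d : Cycles σ)) u,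
    Nat.card_eq_fintype_card, mul_comm, ← smul_eq_mul, ← Finset.card_univ]
  refine Finset.card_nsmul_le_sum _ _ _ fun q _ => ?_
  induction q using Quotient.inductionOn with
  | _ d =>
    obtain ⟨s, hs, hn⟩ := h d
    refine hn.trans (Finset.sum_le_sum_of_subset fun x hx => ?_)
    simp only [Finset.mem_filter, Finset.mem_univ, true_and]
    exact Quotient.eq.2 (hs x hx).symm

end EulerInequality

section FaceCount

variable {V : Type*} {G : SimpleGraph V}

theorem mem_of_sameCycle {D : Type*} {σ : Perm D} (P : D → Prop) (hP : ∀ x, P (σ x) ↔ P x)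
    {x y : D} (h : σ.SameCycle x y) (hx : P x) : P y :=
  Eq.mp (rel_of_sameCycle (Setoid.ker P) (fun x => propext (hP x).symm) h) hx

theorem dart_eq_of_ends {d e : G.Dart} (h1 : d.fst = e.fst) (h2 : d.snd = e.snd) : d = e :=
  SimpleGraph.Dart.ext _ _ (Prod.ext h1 h2)

namespace CrossingMap

/-- The next dart along the boundary of a face of the planarization. -/
def face (R : CrossingMap G) : Perm G.Dart := R.rot * R.cross

theorem face_apply (R : CrossingMap G) (d : G.Dart) : R.face d = R.rot (R.cross d) := rfl

theorem rot_fst (R : CrossingMap G) (d : G.Dart) : (R.rot d).fst = d.fst :=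
  ((R.rot_sameCycle _ _).1 (sameCycle_self_apply R.rot d)).symm

theorem face_fst (R : CrossingMap G) (d : G.Dart) : (R.face d).fst = (R.cross d).fst :=
  R.rot_fst _

theorem face_fst_of_free (R : CrossingMap G) {d : G.Dart} (h : R.Free d) :
    (R.face d).fst = d.snd := by
  rw [face_fst, show R.cross d = d.symm from h]
  rfl

/-- The face after `d` is a triangle whose corners are two vertices and a crossing point. -/
def Kite (R : CrossingMap G) (d : G.Dart) : Prop :=
  R.Free d ∧ ¬ R.Free (R.face d) ∧ R.face (R.face d) = d

/-- The face after `d` is a triangle whose corners are vertices. -/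
def Triangle (R : CrossingMap G) (d : G.Dart) : Prop :=
  R.Free d ∧ R.Free (R.face d) ∧ R.Free (R.face (R.face d)) ∧ R.face (R.face (R.face d)) = d

theorem face_ne_self (R : CrossingMap G) (hR : R.NoAdjacentCrossing) (d : G.Dart) :
    R.face d ≠ d := by
  intro h
  have h1 := R.face_fst d
  rw [h] at h1
  by_cases hd : R.Free d
  · rw [show R.cross d = d.symm from hd] at h1
    exact d.fst_ne_snd h1
  · exact hR d hd h1.symm

theorem cross_ne_self (R : CrossingMap G) (d : G.Dart) : R.cross d ≠ d := by
  intro h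
  rcases R.cross_cases d with h' | h'
  · exact dart_symm_ne d (h'.symm.trans h)
  · rw [h, h] at h'
    exact dart_symm_ne d h'.symm

open Classical in
/-- Twelve times the contribution of the dart `d` to the number of faces, bounded from above. -/
noncomputable def faceWeight (R : CrossingMap G) (d : G.Dart) : ℕ :=
  3 * (if R.Free d then 1 else 2) + 3 * (if R.Kite d then 1 else 0) +
    if R.Triangle d then 1 else 0

theorem three_le_faceWeight (R : CrossingMap G) (d : G.Dart) : 3 ≤ R.faceWeight d := by
  unfold faceWeight
  split_ifs <;> omega

theorem six_le_faceWeight (R : CrossingMap G) {d : G.Dart} (h : ¬ R.Free d ∨ R.Kite d) :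
    6 ≤ R.faceWeight d := by
  unfold faceWeight
  rcases h with h | h
  · rw [if_neg h]
    omega
  · rw [if_pos h]
    split_ifs <;> omega

theorem card_cycles_rot_le [Fintype V] (R : CrossingMap G) :
    Nat.card (Cycles R.rot) ≤ Fintype.card V := by
  rw [← Nat.card_eq_fintype_card]
  refine Nat.card_le_card_of_injective
    (Quotient.lift (fun d : G.Dart => d.fst) fun a b h => (R.rot_sameCycle a b).1 h) ?_
  intro a b
  induction a, b using Quotient.inductionOn₂ with
  | _ a b => exact fun h => Quotient.eq.2 ((R.rot_sameCycle a b).2 h)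

variable [Fintype V] [DecidableRel G.Adj]

theorem card_filter_fst_eq_degree (v : V) [DecidableEq V] :
    (Finset.univ.filter fun d : G.Dart => d.fst = v).card = G.degree v := by
  rw [G.dart_fst_fiber_card_eq_degree]

theorem rot_ne_self (R : CrossingMap G) (hmin : ∀ v, 7 ≤ G.degree v) (d : G.Dart) :
    R.rot d ≠ d := by
  classical
  intro h
  have h1 := card_filter_fst_eq_degree (G := G) d.fst
  have h2 : (Finset.univ.filter fun e : G.Dart => e.fst = d.fst) ⊆ {d} := by
    intro e he
    simp only [Finset.mem_filter, Finset.mem_univ, true_and] at he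
    obtain ⟨i, hi⟩ := (R.rot_sameCycle d e).2 he.symm
    rw [Perm.zpow_apply_eq_self_of_apply_eq_self h] at hi
    simp [hi]
  have h3 := Finset.card_le_card h2
  have h4 := hmin d.fst
  rw [Finset.card_singleton] at h3
  omega

theorem not_free_of_face_face (R : CrossingMap G) (hmin : ∀ v, 7 ≤ G.degree v) {d : G.Dart}
    (h : R.face (R.face d) = d) (hd : R.Free d) : ¬ R.Free (R.face d) := by
  intro he
  have h1 := R.face_fst_of_free hd
  have h2 := R.face_fst_of_free he
  rw [h] at h2
  have h3 : R.face d = d.symm := dart_eq_of_ends h1 h2.symm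
  rw [face_apply, show R.cross d = d.symm from hd] at h3
  exact R.rot_ne_self hmin _ h3

theorem card_cycles_face_le (R : CrossingMap G) (hR : R.NoAdjacentCrossing)
    (hmin : ∀ v, 7 ≤ G.degree v) : 12 * Nat.card (Cycles R.face) ≤ ∑ d, R.faceWeight d := by
  classical
  refine mul_card_cycles_le _ _ _ fun d => ?_
  have hs : ∀ x, R.face.SameCycle x (R.face x) := sameCycle_self_apply _
  have n1 := R.face_ne_self hR
  have w := R.three_le_faceWeight
  by_cases h2 : R.face (R.face d) = d
  · refine ⟨{d, R.face d}, ?_, ?_⟩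
    · simp only [Finset.mem_insert, Finset.mem_singleton, forall_eq_or_imp, forall_eq]
      exact ⟨Perm.SameCycle.refl _ _, hs d⟩
    · rw [Finset.sum_pair (n1 d).symm]
      have a1 : 6 ≤ R.faceWeight d := R.six_le_faceWeight (by
        by_cases h : R.Free d
        · exact Or.inr ⟨h, R.not_free_of_face_face hmin h2 h, h2⟩
        · exact Or.inl h)
      have a2 : 6 ≤ R.faceWeight (R.face d) := R.six_le_faceWeight (by
        by_cases h : R.Free (R.face d)
        · exact Or.inr ⟨h, R.not_free_of_face_face hmin (by rw [h2]) h, by rw [h2]⟩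
        · exact Or.inl h)
      omega
  · have n2 : d ≠ R.face (R.face d) := Ne.symm h2
    have n3 : R.face d ≠ R.face (R.face d) := (n1 _).symm
    by_cases h3 : R.face (R.face (R.face d)) = d
    · refine ⟨{d, R.face d, R.face (R.face d)}, ?_, ?_⟩
      · simp only [Finset.mem_insert, Finset.mem_singleton, forall_eq_or_imp, forall_eq]
        exact ⟨Perm.SameCycle.refl _ _, hs d, (hs d).trans (hs _)⟩
      · rw [Finset.sum_insert (by simp [(n1 d).symm, n2]), Finset.sum_pair n3]
        have w0 := w d
        have w1 := w (R.face d)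
        have w2 := w (R.face (R.face d))
        by_cases f0 : R.Free d
        · by_cases f1 : R.Free (R.face d)
          · by_cases f2 : R.Free (R.face (R.face d))
            · have a : ∀ x, R.Free x → R.Triangle x → 4 ≤ R.faceWeight x := by
                intro x hx hx'
                unfold faceWeight
                rw [if_pos hx, if_pos hx']
                omega
              have a0 := a d f0 ⟨f0, f1, f2, h3⟩
              have a1 := a _ f1 ⟨f1, f2, by rwa [h3], by rw [h3]⟩
              have a2 := a _ f2 ⟨f2, by rwa [h3], by rwa [h3], by rw [h3]⟩
              omega
            · have := R.six_le_faceWeight (Or.inl f2)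
              omega
          · have := R.six_le_faceWeight (Or.inl f1)
            omega
        · have := R.six_le_faceWeight (Or.inl f0)
          omega
    · refine ⟨{d, R.face d, R.face (R.face d), R.face (R.face (R.face d))}, ?_, ?_⟩
      · simp only [Finset.mem_insert, Finset.mem_singleton, forall_eq_or_imp, forall_eq]
        exact ⟨Perm.SameCycle.refl _ _, hs d, (hs d).trans (hs _),
          ((hs d).trans (hs _)).trans (hs _)⟩
      · have n4 : R.face d ≠ R.face (R.face (R.face d)) := fun h => n2 (R.face.injective h)
        have n5 : R.face (R.face d) ≠ R.face (R.face (R.face d)) := (n1 _).symm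
        rw [Finset.sum_insert (by simp [(n1 d).symm, n2, Ne.symm h3]),
          Finset.sum_insert (by simp [n3, n4]), Finset.sum_pair n5]
        have w0 := w d
        have w1 := w (R.face d)
        have w2 := w (R.face (R.face d))
        have w3 := w (R.face (R.face (R.face d)))
        omega

open Classical in
theorem card_cycles_cross_le (R : CrossingMap G) :
    4 * Nat.card (Cycles R.cross) ≤ ∑ d, if R.Free d then 2 else 1 := by
  refine mul_card_cycles_le _ _ _ fun d => ?_
  have hs : ∀ x, R.cross.SameCycle x (R.cross x) := sameCycle_self_apply _
  by_cases hd : R.Free d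
  · refine ⟨{d, d.symm}, ?_, ?_⟩
    · simp only [Finset.mem_insert, Finset.mem_singleton, forall_eq_or_imp, forall_eq]
      refine ⟨Perm.SameCycle.refl _ _, ?_⟩
      have := hs d
      rwa [show R.cross d = d.symm from hd] at this
    · rw [Finset.sum_pair (dart_symm_ne d).symm, if_pos hd, if_pos ((R.free_symm d).2 hd)]
  · have h2 := R.cross_cross_of_not_free hd
    have h1 := R.cross_ne_self d
    have h3 : R.cross d ≠ d.symm := hd
    refine ⟨{d, R.cross d, d.symm, (R.cross d).symm}, ?_, ?_⟩
    · simp only [Finset.mem_insert, Finset.mem_singleton, forall_eq_or_imp, forall_eq]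
      have a1 := hs d
      have a2 := a1.trans (hs _)
      have a3 := a2.trans (hs _)
      rw [h2] at a2
      rw [h2, R.cross_symm] at a3
      exact ⟨Perm.SameCycle.refl _ _, a1, a2, a3⟩
    · have h4 : d ≠ (R.cross d).symm := fun h => h3 (by
        rw [← dart_symm_symm (R.cross d), ← h])
      have h5 : d.symm ≠ (R.cross d).symm := fun h =>
        h1 (SimpleGraph.Dart.symm_involutive.injective h).symm
      rw [Finset.sum_insert (by simp [h1.symm, h4, (dart_symm_ne d).symm]),
        Finset.sum_insert (by simp [h3, (dart_symm_ne _).symm]), Finset.sum_pair h5]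
      have : ∀ x, 1 ≤ if R.Free x then 2 else 1 := fun x => by split_ifs <;> omega
      have b1 := this d
      have b2 := this (R.cross d)
      have b3 := this d.symm
      have b4 := this (R.cross d).symm
      omega

theorem cycleSum_cross_of_free (R : CrossingMap G) (z : G.Dart → ZMod 2) {d : G.Dart}
    (hd : R.Free d) : cycleSum R.cross z d = z d + z d.symm := by
  classical
  have hd' : R.cross d.symm = d := by
    rw [R.cross_symm, show R.cross d = d.symm from hd, dart_symm_symm]
  rw [cycleSum_eq_sum _ _ _ {d, d.symm}, Finset.sum_pair (dart_symm_ne d).symm]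
  intro x
  simp only [Finset.mem_insert, Finset.mem_singleton]
  refine ⟨fun h => mem_of_sameCycle (fun x => x = d ∨ x = d.symm) (fun x => ⟨?_, ?_⟩) h
    (Or.inl rfl), ?_⟩
  · rintro (h | h)
    · exact Or.inr (R.cross.injective (h.trans hd'.symm))
    · exact Or.inl (R.cross.injective (h.trans hd.symm))
  · rintro (rfl | rfl)
    · exact Or.inr hd
    · exact Or.inl hd'
  · rintro (rfl | rfl)
    · exact Perm.SameCycle.refl _ _
    · have := sameCycle_self_apply R.cross d
      rwa [show R.cross d = d.symm from hd] at this

theorem cycleSum_cross_of_not_free (R : CrossingMap G) (z : G.Dart → ZMod 2) {d : G.Dart}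
    (hd : ¬ R.Free d) :
    cycleSum R.cross z d = z d + z (R.cross d) + z d.symm + z (R.cross d).symm := by
  classical
  have h2 := R.cross_cross_of_not_free hd
  have h3 := R.cross_symm d
  have h4 : R.cross (R.cross d).symm = d := by rw [R.cross_symm, h2, dart_symm_symm]
  have n1 := (R.cross_ne_self d).symm
  have n2 : R.cross d ≠ d.symm := hd
  have n3 : d ≠ (R.cross d).symm := fun h => n2 (by rw [← dart_symm_symm (R.cross d), ← h])
  have n4 : d.symm ≠ (R.cross d).symm := fun h =>
    n1 (SimpleGraph.Dart.symm_involutive.injective h)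
  rw [cycleSum_eq_sum _ _ _ {d, R.cross d, d.symm, (R.cross d).symm},
    Finset.sum_insert (by simp [n1, n3, (dart_symm_ne d).symm]),
    Finset.sum_insert (by simp [n2, (dart_symm_ne _).symm]), Finset.sum_pair n4]
  · ring
  intro x
  simp only [Finset.mem_insert, Finset.mem_singleton]
  refine ⟨fun h => mem_of_sameCycle
    (fun x => x = d ∨ x = R.cross d ∨ x = d.symm ∨ x = (R.cross d).symm) (fun x => ⟨?_, ?_⟩) h
    (Or.inl rfl), ?_⟩
  · rintro (h | h | h | h)
    · exact Or.inr (Or.inr (Or.inr (R.cross.injective (h.trans h4.symm))))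
    · exact Or.inl (R.cross.injective h)
    · exact Or.inr (Or.inl (R.cross.injective (h.trans h2.symm)))
    · exact Or.inr (Or.inr (Or.inl (R.cross.injective (h.trans h3.symm))))
  · rintro (rfl | rfl | rfl | rfl)
    · exact Or.inr (Or.inl rfl)
    · exact Or.inr (Or.inr (Or.inl h2))
    · exact Or.inr (Or.inr (Or.inr h3))
    · exact Or.inl h4
  · have a1 := sameCycle_self_apply R.cross d
    have a2 := a1.trans (sameCycle_self_apply R.cross _)
    have a3 := a2.trans (sameCycle_self_apply R.cross _)
    rw [h2] at a2
    rw [h2, h3] at a3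
    rintro (rfl | rfl | rfl | rfl)
    exacts [Perm.SameCycle.refl _ _, a1, a2, a3]

open Classical in
theorem euler_count [Nonempty V] (R : CrossingMap G) (hP : R.Planar) (hR : R.NoAdjacentCrossing)
    (hmin : ∀ v, 7 ≤ G.degree v) :
    3 * Fintype.card G.Dart + 24 ≤ 12 * Fintype.card V +
      ∑ d, (3 * (if R.Kite d then 1 else 0) + if R.Triangle d then 1 else 0) := by
  have hne : Nonempty G.Dart := by
    obtain ⟨v⟩ := ‹Nonempty V›
    have h := hmin v
    rw [← card_filter_fst_eq_degree] at h
    obtain ⟨d, -⟩ := Finset.card_pos.1 (lt_of_lt_of_le (by norm_num) h)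
    exact ⟨d⟩
  have h0 := card_add_two_le_card_cycles R.rot R.cross fun z hz1 hz2 => by
    refine hP z (fun d hd => ?_) (fun d hd => ?_) hz1
    · have := hz2 d
      rw [R.cycleSum_cross_of_free z hd] at this
      linear_combination this - zmod_two_add_self (z d.symm)
    · rw [← R.cycleSum_cross_of_not_free z hd, hz2]
  have h1 := R.card_cycles_rot_le
  have h2 := R.card_cycles_cross_le
  have h3 := R.card_cycles_face_le hR hmin
  have h4 : ∑ d, R.faceWeight d + 3 * ∑ d, (if R.Free d then 2 else 1) = 9 * Fintype.card G.Dart +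
      ∑ d, (3 * (if R.Kite d then 1 else 0) + if R.Triangle d then 1 else 0) := by
    have : 9 * Fintype.card G.Dart = ∑ d : G.Dart, 9 := by simp [mul_comm]
    rw [this, Finset.mul_sum, ← Finset.sum_add_distrib, ← Finset.sum_add_distrib]
    refine Finset.sum_congr rfl fun d _ => ?_
    unfold faceWeight
    by_cases h : R.Free d
    · simp only [if_pos h]
      omega
    · simp only [if_neg h]
      omega
  rw [Nat.card_eq_fintype_card] at h0
  change _ ≤ _ + Nat.card (Cycles R.face) at h0
  omega

end CrossingMap

end FaceCount

section LocalStructure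

variable {V : Type*} {G : SimpleGraph V}

namespace CrossingMap

theorem cross_eq_rot_symm_face (R : CrossingMap G) (d : G.Dart) :
    R.cross d = R.rot.symm (R.face d) :=
  (R.rot.symm_apply_apply _).symm

theorem rot_symm_fst (R : CrossingMap G) (d : G.Dart) : (R.rot.symm d).fst = d.fst := by
  rw [← R.rot_fst (R.rot.symm d), Equiv.apply_symm_apply]

/-- The corner between `R.rot.symm d` and `d` belongs to a face bounded by two vertices and a
crossing point. -/
def KiteCorner (R : CrossingMap G) (d : G.Dart) : Prop := R.Kite d ∨ R.Kite (R.face d)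

variable {R : CrossingMap G} {d : G.Dart}

theorem Triangle.face (h : R.Triangle d) : R.Triangle (R.face d) := by
  obtain ⟨h1, h2, h3, h4⟩ := h
  exact ⟨h2, h3, by rwa [h4], by rw [h4]⟩

theorem triangle_face_iff : R.Triangle (R.face d) ↔ R.Triangle d :=
  ⟨fun h => R.face.injective h.2.2.2 ▸ h.face.face, Triangle.face⟩

theorem Triangle.rot_symm (h : R.Triangle d) : R.rot.symm d = (R.face (R.face d)).symm := by
  have h1 : R.cross (R.face (R.face d)) = (R.face (R.face d)).symm := h.2.2.1
  rw [← h1, cross_eq_rot_symm_face, h.2.2.2]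

theorem Triangle.free_rot_symm (h : R.Triangle d) : R.Free (R.rot.symm d) := by
  rw [h.rot_symm, R.free_symm]
  exact h.2.2.1

theorem Kite.not_free_rot_symm (h : R.Kite d) : ¬ R.Free (R.rot.symm d) := by
  have h1 := R.cross_eq_rot_symm_face (R.face d)
  rw [h.2.2] at h1
  rw [← h1, R.free_cross]
  exact h.2.1

theorem kite_of_kite_face (h : R.Kite (R.face d)) :
    ¬ R.Free d ∧ R.Free (R.rot.symm d) ∧ R.face d = (R.rot.symm d).symm := by
  obtain ⟨h1, h2, h3⟩ := h
  have h4 : R.face (R.face d) = d := R.face.injective h3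
  rw [h4] at h2
  have h5 : R.rot.symm d = (R.face d).symm := by
    have h6 : R.cross (R.face d) = (R.face d).symm := h1
    rw [← h6, cross_eq_rot_symm_face, h4]
  refine ⟨h2, ?_, ?_⟩
  · rw [h5, R.free_symm]
    exact h1
  · rw [h5, dart_symm_symm]

theorem KiteCorner.free_iff (h : R.KiteCorner d) : R.Free d ↔ ¬ R.Free (R.rot.symm d) := by
  rcases h with h | h
  · exact iff_of_true h.1 h.not_free_rot_symm
  · have := kite_of_kite_face h
    exact iff_of_false this.1 fun h' => h' this.2.1

theorem KiteCorner.kite (h : R.KiteCorner d) (hd : R.Free d) : R.Kite d :=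
  h.resolve_right fun h' => (kite_of_kite_face h').1 hd

theorem KiteCorner.kite_symm (h : R.KiteCorner d) (hd : R.Free (R.rot.symm d)) :
    R.Kite (R.rot.symm d).symm := by
  rcases h with h | h
  · exact absurd hd h.not_free_rot_symm
  · rw [← (kite_of_kite_face h).2.2]
    exact h

theorem Triangle.not_kiteCorner (h : R.Triangle d) : ¬ R.KiteCorner d := fun h' =>
  h'.free_iff.1 h.1 h.free_rot_symm

/-- Two consecutive kite corners that share a crossed edge: the edge crossing it joins the ends
of the neighbouring edges. -/
theorem adj_of_kite {e : G.Dart} (h1 : R.Kite (R.rot.symm e).symm) (h2 : R.Kite (R.rot e)) :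
    G.Adj (R.rot.symm e).snd (R.rot e).snd := by
  have a1 : R.face (R.rot.symm e).symm = e := by
    rw [face_apply, show R.cross (R.rot.symm e).symm = _ from h1.1, dart_symm_symm,
      Equiv.apply_symm_apply]
  have a2 : (R.cross e).fst = (R.rot.symm e).snd := by
    have := h1.2.2
    rw [a1] at this
    rw [← R.face_fst, this]
    rfl
  have a3 : R.cross (R.face (R.rot e)) = e := by
    rw [cross_eq_rot_symm_face, h2.2.2, Equiv.symm_apply_apply]
  have a4 : R.cross e = (R.face (R.rot e)).symm := by
    have := R.cross_cross_of_not_free h2.2.1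
    rwa [a3] at this
  have a5 : (R.cross e).snd = (R.rot e).snd := by
    rw [a4, ← R.face_fst_of_free h2.1]
    rfl
  rw [← a2, ← a5]
  exact (R.cross e).adj

theorem face_symm_of_free (hd : R.Free d) : R.face d.symm = R.rot d := by
  rw [face_apply, R.cross_symm, show R.cross d = d.symm from hd, dart_symm_symm]

theorem Triangle.adj (h : R.Triangle d) : G.Adj d.fst (R.face d).fst ∧
    G.Adj (R.face d).fst (R.face (R.face d)).fst ∧ G.Adj (R.face (R.face d)).fst d.fst := by
  have h0 := d.adj
  have h1 := (R.face d).adj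
  have h2 := (R.face (R.face d)).adj
  rw [← R.face_fst_of_free h.1] at h0
  rw [← R.face_fst_of_free h.2.1] at h1
  rw [← R.face_fst_of_free h.2.2.1, h.2.2.2] at h2
  exact ⟨h0, h1, h2⟩

theorem sum_triangle_face [Fintype V] [DecidableRel G.Adj] (R : CrossingMap G) (f : G.Dart → ℕ) :
    (∑ d, open Classical in if R.Triangle d then f (R.face d) else 0) =
      ∑ d, open Classical in if R.Triangle d then f d else 0 := by
  classical
  rw [← Equiv.sum_comp R.face fun d => if R.Triangle d then f d else 0]
  simp only [triangle_face_iff]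

theorem sum_kiteCorner [Fintype V] [DecidableRel G.Adj] (R : CrossingMap G) :
    (∑ d, open Classical in if R.KiteCorner d then 1 else 0) =
      2 * ∑ d, open Classical in if R.Kite d then 1 else 0 := by
  classical
  have h := Equiv.sum_comp R.face fun d => if R.Kite d then 1 else 0
  rw [two_mul]
  nth_rewrite 2 [← h]
  rw [← Finset.sum_add_distrib]
  refine Finset.sum_congr rfl fun d _ => ?_
  by_cases h1 : R.Kite d
  · rw [if_pos (show R.KiteCorner d from Or.inl h1), if_pos h1,
      if_neg fun h2 => (kite_of_kite_face h2).1 h1.1]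
  · by_cases h2 : R.Kite (R.face d)
    · rw [if_pos (show R.KiteCorner d from Or.inr h2), if_neg h1, if_pos h2]
    · rw [if_neg (show ¬ R.KiteCorner d from fun h => h.elim h1 h2), if_neg h1, if_neg h2]

variable [Fintype V] [DecidableRel G.Adj]

theorem rot_pow_degree (R : CrossingMap G) (hmin : ∀ v, 7 ≤ G.degree v) (d : G.Dart) :
    (R.rot ^ G.degree d.fst) d = d := by
  classical
  have hc := Perm.isCycle_cycleOf R.rot (R.rot_ne_self hmin d)
  have h1 : (R.rot.cycleOf d).support = Finset.univ.filter fun e : G.Dart => e.fst = d.fst := by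
    ext e
    rw [Perm.mem_support_cycleOf_iff, R.rot_sameCycle, Perm.mem_support]
    simp [R.rot_ne_self hmin d, eq_comm]
  rw [← card_filter_fst_eq_degree, ← h1, ← hc.orderOf, ← Perm.cycleOf_pow_apply_self,
    pow_orderOf_eq_one]
  rfl

/-- The corner at `d` belongs to a triangular face with at least two vertices of degree `7`. -/
def Needy (R : CrossingMap G) (d : G.Dart) : Prop :=
  R.Triangle d ∧ ((G.degree d.fst = 7 ∧ G.degree (R.face d).fst = 7) ∨
    (G.degree (R.face d).fst = 7 ∧ G.degree (R.face (R.face d)).fst = 7) ∨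
    (G.degree (R.face (R.face d)).fst = 7 ∧ G.degree d.fst = 7))

theorem needy_face_iff : R.Needy (R.face d) ↔ R.Needy d := by
  unfold Needy
  rw [triangle_face_iff]
  refine and_congr_right fun h => ?_
  rw [h.2.2.2]
  tauto

/-- Every corner at `v` is a kite corner or needy. -/
def Full (R : CrossingMap G) (v : V) : Prop := ∀ d : G.Dart, d.fst = v → R.KiteCorner d ∨ R.Needy d

/-- A full vertex with at most one corner that is not a kite corner. -/
def Bad (R : CrossingMap G) (v : V) : Prop := R.Full v ∧ ∀ d e : G.Dart, d.fst = v → e.fst = v →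
  ¬ R.KiteCorner d → ¬ R.KiteCorner e → d = e

theorem Full.needy_of_triangle (h : R.Full d.fst) (hd : R.Triangle d) : R.Needy d :=
  (h d rfl).resolve_left hd.not_kiteCorner

theorem Bad.kite_symm (hmin : ∀ v, 7 ≤ G.degree v) (h : R.Bad (R.face d).fst)
    (hd : R.Triangle d) : R.Kite d.symm := by
  have h1 : R.KiteCorner d.symm := by
    by_contra h1
    have h2 := h.2 _ d.symm rfl (R.face_fst_of_free hd.1).symm hd.face.not_kiteCorner h1
    rw [face_apply, show R.cross d = d.symm from hd.1] at h2
    exact R.rot_ne_self hmin _ h2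
  exact h1.kite ((R.free_symm d).2 hd.1)

theorem Bad.not_free_rot (hmin : ∀ v, 7 ≤ G.degree v) (h : R.Bad (R.face d).fst)
    (hd : R.Triangle d) : ¬ R.Free (R.rot d) := by
  rw [← face_symm_of_free hd.1]
  exact (h.kite_symm hmin hd).2.1

theorem Bad.kite_rot_symm (hmin : ∀ v, 7 ≤ G.degree v) (h : R.Bad (R.face (R.face d)).fst)
    (hd : R.Triangle d) : R.Kite (R.rot.symm d) := by
  have h1 : R.KiteCorner (R.rot (R.face (R.face d))) := by
    by_contra h1
    exact R.rot_ne_self hmin _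
      (h.2 _ _ (R.rot_fst _) rfl h1 hd.face.face.not_kiteCorner)
  have h2 := h1.kite_symm (by rw [Equiv.symm_apply_apply]; exact hd.2.2.1)
  rwa [Equiv.symm_apply_apply, ← hd.rot_symm] at h2

end CrossingMap

end LocalStructure

section Charges

variable {V : Type*} {G : SimpleGraph V} [Fintype V] [DecidableRel G.Adj]

namespace CrossingMap

open Classical in
/-- The charge that a vertex of degree `7` gives to each of its needy corners. -/
noncomputable def share (R : CrossingMap G) (v : V) : ℕ :=
  if ¬ R.Full v then 3 else if R.Bad v then 0 else 2

open Classical in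
/-- The charge given to the corner at `d` by its vertex. -/
noncomputable def charge (R : CrossingMap G) (d : G.Dart) : ℕ :=
  if R.KiteCorner d then 3
  else if R.Needy d then
    if G.degree d.fst = 7 then R.share d.fst
    else 6 - R.share (R.face d).fst - R.share (R.face (R.face d)).fst
  else if R.Triangle d ∧ G.degree d.fst ≠ 7 then 3 else 0

variable {R : CrossingMap G} {d : G.Dart}

theorem share_le (v : V) : R.share v ≤ 3 := by
  unfold share
  split_ifs <;> omega

theorem charge_of_kiteCorner (h : R.KiteCorner d) : R.charge d = 3 := if_pos h

theorem charge_of_needy (h : R.Needy d) (hd : G.degree d.fst = 7) :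
    R.charge d = R.share d.fst := by
  unfold charge
  rw [if_neg h.1.not_kiteCorner, if_pos h, if_pos hd]

theorem charge_of_needy' (h : R.Needy d) (hd : G.degree d.fst ≠ 7) :
    R.charge d = 6 - R.share (R.face d).fst - R.share (R.face (R.face d)).fst := by
  unfold charge
  rw [if_neg h.1.not_kiteCorner, if_pos h, if_neg hd]

theorem charge_of_triangle (h : R.Triangle d) (hn : ¬ R.Needy d) (hd : G.degree d.fst ≠ 7) :
    R.charge d = 3 := by
  unfold charge
  rw [if_neg h.not_kiteCorner, if_neg hn, if_pos ⟨h, hd⟩]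

theorem charge_of_not_triangle (h : ¬ R.Triangle d) (hk : ¬ R.KiteCorner d) : R.charge d = 0 := by
  unfold charge
  rw [if_neg hk, if_neg fun h' => h h'.1, if_neg fun h' => h h'.1]

theorem charge_eq_zero (h : ¬ R.Needy d) (hk : ¬ R.KiteCorner d) (hd : G.degree d.fst = 7) :
    R.charge d = 0 := by
  unfold charge
  rw [if_neg hk, if_neg h, if_neg fun h' => h'.2 hd]

theorem charge_le_three_of_not_needy (h : ¬ R.Needy d) : R.charge d ≤ 3 := by
  unfold charge
  rw [if_neg h]
  split_ifs <;> omega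

theorem Needy.degree_cases
    (hno : ∀ a b c : V, G.Adj a b → G.Adj b c → G.Adj a c → G.degree a = 7 → G.degree b = 7 →
      10 ≤ G.degree c) (h : R.Needy d) :
    (10 ≤ G.degree d.fst ∧ G.degree (R.face d).fst = 7 ∧ G.degree (R.face (R.face d)).fst = 7) ∨
    (10 ≤ G.degree (R.face d).fst ∧ G.degree d.fst = 7 ∧ G.degree (R.face (R.face d)).fst = 7) ∨
    (10 ≤ G.degree (R.face (R.face d)).fst ∧ G.degree d.fst = 7 ∧ G.degree (R.face d).fst = 7) := by
  obtain ⟨ht, h⟩ := h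
  obtain ⟨a1, a2, a3⟩ := ht.adj
  rcases h with ⟨h1, h2⟩ | ⟨h1, h2⟩ | ⟨h1, h2⟩
  · exact Or.inr (Or.inr ⟨hno _ _ _ a1 a2 a3.symm h1 h2, h1, h2⟩)
  · exact Or.inl ⟨hno _ _ _ a2 a3 a1.symm h1 h2, h1, h2⟩
  · exact Or.inr (Or.inl ⟨hno _ _ _ a3 a1 a2.symm h1 h2, h2, h1⟩)

theorem Triangle.six_le_charge
    (hno : ∀ a b c : V, G.Adj a b → G.Adj b c → G.Adj a c → G.degree a = 7 → G.degree b = 7 →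
      10 ≤ G.degree c) (h : R.Triangle d) :
    6 ≤ R.charge d + R.charge (R.face d) + R.charge (R.face (R.face d)) := by
  have h3 := h.2.2.2
  by_cases hn : R.Needy d
  · have hn1 := needy_face_iff.2 hn
    have hn2 := needy_face_iff.2 hn1
    have s0 := share_le (R := R) d.fst
    have s1 := share_le (R := R) (R.face d).fst
    have s2 := share_le (R := R) (R.face (R.face d)).fst
    rcases hn.degree_cases hno with ⟨g0, g1, g2⟩ | ⟨g0, g1, g2⟩ | ⟨g0, g1, g2⟩
    · rw [charge_of_needy' hn (by omega), charge_of_needy hn1 g1, charge_of_needy hn2 g2]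
      omega
    · rw [charge_of_needy hn g1, charge_of_needy' hn1 (by omega), charge_of_needy hn2 g2, h3]
      omega
    · rw [charge_of_needy hn g1, charge_of_needy hn1 g2, charge_of_needy' hn2 (by omega), h3]
      omega
  · have hn1 := mt needy_face_iff.1 hn
    have hn2 := mt needy_face_iff.1 hn1
    by_cases g0 : G.degree d.fst = 7
    · rw [charge_of_triangle h.face hn1 fun g1 => hn ⟨h, Or.inl ⟨g0, g1⟩⟩,
        charge_of_triangle h.face.face hn2 fun g2 => hn ⟨h, Or.inr (Or.inr ⟨g2, g0⟩)⟩]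
      omega
    · rw [charge_of_triangle h hn g0]
      by_cases g1 : G.degree (R.face d).fst = 7
      · rw [charge_of_triangle h.face.face hn2 fun g2 => hn ⟨h, Or.inr (Or.inl ⟨g1, g2⟩)⟩]
        omega
      · rw [charge_of_triangle h.face hn1 g1]
        omega

theorem sum_charge_ge
    (hno : ∀ a b c : V, G.Adj a b → G.Adj b c → G.Adj a c → G.degree a = 7 → G.degree b = 7 →
      10 ≤ G.degree c) (R : CrossingMap G) :
    2 * (∑ d, open Classical in
      (3 * (if R.Kite d then 1 else 0) + if R.Triangle d then 1 else 0)) ≤ ∑ d, R.charge d := by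
  classical
  have h1 : 3 * (∑ d, if R.KiteCorner d then 1 else 0) +
      (∑ d, if R.Triangle d then R.charge d else 0) ≤ ∑ d, R.charge d := by
    rw [Finset.mul_sum, ← Finset.sum_add_distrib]
    refine Finset.sum_le_sum fun d _ => ?_
    by_cases h : R.KiteCorner d
    · rw [if_pos h, if_neg fun h' => h'.not_kiteCorner h, charge_of_kiteCorner h, mul_one, add_zero]
    · rw [if_neg h]
      split_ifs <;> omega
  have h2 : 6 * (∑ d, if R.Triangle d then 1 else 0) ≤
      3 * ∑ d, if R.Triangle d then R.charge d else 0 := by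
    have e1 := R.sum_triangle_face R.charge
    have e2 := R.sum_triangle_face fun d => R.charge (R.face d)
    have e3 : 3 * (∑ d, if R.Triangle d then R.charge d else 0) =
        (∑ d, if R.Triangle d then R.charge d else 0) +
        (∑ d, if R.Triangle d then R.charge (R.face d) else 0) +
        ∑ d, if R.Triangle d then R.charge (R.face (R.face d)) else 0 := by
      rw [e2, e1]
      ring
    rw [e3, Finset.mul_sum, ← Finset.sum_add_distrib, ← Finset.sum_add_distrib]
    refine Finset.sum_le_sum fun d _ => ?_
    split_ifs with h
    · exact h.six_le_charge hno
    · omega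
  rw [sum_kiteCorner] at h1
  rw [Finset.sum_add_distrib, ← Finset.mul_sum]
  omega

end CrossingMap

end Charges

section Vertices

variable {V : Type*} {G : SimpleGraph V} [Fintype V] [DecidableRel G.Adj]

namespace CrossingMap

open Classical in
/-- The darts at `v`. -/
noncomputable def dartsAt (_ : CrossingMap G) (v : V) : Finset G.Dart := {d | d.fst = v}

open Classical in
/-- The corners at `v` between two edges that are not crossed. -/
noncomputable def openCorners (R : CrossingMap G) (v : V) : Finset G.Dart :=
  {d | d.fst = v ∧ R.Free d ∧ R.Free (R.rot.symm d)}

open Classical in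
/-- The corners at `v` between a crossed edge and an edge that is not crossed. -/
noncomputable def entries (R : CrossingMap G) (v : V) : Finset G.Dart :=
  {d | d.fst = v ∧ R.Free d ∧ ¬ R.Free (R.rot.symm d)}

open Classical in
/-- The darts at `v` that are not crossed and are followed by a crossed one. -/
noncomputable def exits (R : CrossingMap G) (v : V) : Finset G.Dart :=
  {d | d.fst = v ∧ R.Free d ∧ ¬ R.Free (R.rot d)}

variable {R : CrossingMap G} {d : G.Dart} {v : V}

theorem mem_openCorners :
    d ∈ R.openCorners v ↔ d.fst = v ∧ R.Free d ∧ R.Free (R.rot.symm d) := by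
  simp [openCorners]

theorem mem_entries : d ∈ R.entries v ↔ d.fst = v ∧ R.Free d ∧ ¬ R.Free (R.rot.symm d) := by
  simp [entries]

theorem mem_exits : d ∈ R.exits v ↔ d.fst = v ∧ R.Free d ∧ ¬ R.Free (R.rot d) := by
  simp [exits]

theorem mem_dartsAt : d ∈ R.dartsAt v ↔ d.fst = v := by
  simp [dartsAt]

theorem card_dartsAt (R : CrossingMap G) (v : V) : (R.dartsAt v).card = G.degree v := by
  classical
  rw [← card_filter_fst_eq_degree]
  congr 1

theorem card_exits (R : CrossingMap G) (v : V) : (R.exits v).card = (R.entries v).card := by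
  classical
  have h1 : ((R.dartsAt v).filter fun d => R.Free d).card =
      (R.entries v).card + (R.openCorners v).card := by
    rw [← Finset.card_filter_add_card_filter_not (s := (R.dartsAt v).filter fun d => R.Free d)
      (fun d => R.Free (R.rot.symm d)), add_comm]
    congr 2 <;> ext d <;> simp [mem_dartsAt, mem_entries, mem_openCorners, and_assoc]
  have h2 : ((R.dartsAt v).filter fun d => R.Free d).card =
      (R.exits v).card + (R.openCorners v).card := by
    rw [← Finset.card_filter_add_card_filter_not (s := (R.dartsAt v).filter fun d => R.Free d)
      (fun d => R.Free (R.rot d)), add_comm]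
    congr 1
    · congr 1
      ext d
      simp [mem_dartsAt, mem_exits, and_assoc]
    · refine Finset.card_equiv R.rot fun d => ?_
      simp only [Finset.mem_filter, mem_dartsAt, mem_openCorners, R.rot_fst,
        Equiv.symm_apply_apply]
      tauto
  omega

theorem charge_le_three_of_not_openCorner (h : d ∉ R.openCorners d.fst) : R.charge d ≤ 3 :=
  charge_le_three_of_not_needy fun hn =>
    h (mem_openCorners.2 ⟨rfl, hn.1.1, hn.1.free_rot_symm⟩)

theorem not_kiteCorner_of_mem_openCorners (h : d ∈ R.openCorners v) : ¬ R.KiteCorner d := by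
  rw [mem_openCorners] at h
  exact fun hk => hk.free_iff.1 h.2.1 h.2.2

theorem sum_charge_le (R : CrossingMap G) (v : V) :
    2 * (R.entries v).card + (R.openCorners v).card ≤ G.degree v ∧
    ∑ d ∈ R.dartsAt v, R.charge d ≤
      6 * (R.entries v).card + ∑ d ∈ R.openCorners v, R.charge d := by
  classical
  set L := (R.dartsAt v).filter fun d => ¬ R.Free d ∧ R.Free (R.rot.symm d) with hL
  set C := (R.dartsAt v).filter fun d => ¬ R.Free d ∧ ¬ R.Free (R.rot.symm d) with hC
  have hLc : L.card = (R.entries v).card := by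
    rw [← card_exits]
    refine Finset.card_equiv R.rot.symm fun d => ?_
    simp only [hL, Finset.mem_filter, mem_dartsAt, mem_exits, R.rot_symm_fst,
      Equiv.apply_symm_apply]
    tauto
  have hsum : ∀ f : G.Dart → ℕ, ∑ d ∈ R.dartsAt v, f d =
      ∑ d ∈ R.openCorners v, f d + ∑ d ∈ R.entries v, f d + (∑ d ∈ L, f d + ∑ d ∈ C, f d) := by
    intro f
    rw [← Finset.sum_filter_add_sum_filter_not (R.dartsAt v) (fun d => R.Free d),
      ← Finset.sum_filter_add_sum_filter_not ((R.dartsAt v).filter fun d => R.Free d)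
        (fun d => R.Free (R.rot.symm d)),
      ← Finset.sum_filter_add_sum_filter_not ((R.dartsAt v).filter fun d => ¬ R.Free d)
        (fun d => R.Free (R.rot.symm d))]
    simp only [Finset.filter_filter]
    congr 2
    · refine Finset.sum_congr ?_ fun _ _ => rfl
      ext d
      simp [mem_dartsAt, mem_openCorners]
    · refine Finset.sum_congr ?_ fun _ _ => rfl
      ext d
      simp [mem_dartsAt, mem_entries]
  have h3 : ∀ d, d.fst = v → (R.Free d → ¬ R.Free (R.rot.symm d)) → R.charge d ≤ 3 := by
    rintro d rfl h
    exact charge_le_three_of_not_openCorner fun h' => by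
      rw [mem_openCorners] at h'
      exact h h'.2.1 h'.2.2
  constructor
  · have := hsum fun _ => 1
    simp only [← Finset.card_eq_sum_ones] at this
    rw [card_dartsAt] at this
    omega
  · rw [hsum]
    have s1 : ∑ d ∈ R.entries v, R.charge d ≤ (R.entries v).card * 3 :=
      Finset.sum_le_card_nsmul _ _ _ fun d hd => by
        rw [mem_entries] at hd
        exact h3 d hd.1 fun _ => hd.2.2
    have s2 : ∑ d ∈ L, R.charge d ≤ L.card * 3 :=
      Finset.sum_le_card_nsmul _ _ _ fun d hd => by
        simp only [hL, Finset.mem_filter, mem_dartsAt] at hd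
        exact h3 d hd.1 fun h => absurd h hd.2.1
    have s3 : ∑ d ∈ C, R.charge d = 0 := Finset.sum_eq_zero fun d hd => by
      simp only [hC, Finset.mem_filter, mem_dartsAt] at hd
      refine charge_of_not_triangle (fun h => hd.2.1 h.1) fun h => ?_
      exact hd.2.1 (h.free_iff.2 hd.2.2)
    omega

theorem sum_charge_le_of_degree_seven (hv : G.degree v = 7) :
    ∑ d ∈ R.dartsAt v, R.charge d ≤ 18 := by
  classical
  by_cases hf : R.Full v
  · obtain ⟨h1, h2⟩ := R.sum_charge_le v
    refine h2.trans ?_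
    have h3 : ∑ d ∈ R.openCorners v, R.charge d ≤ (R.openCorners v).card * R.share v :=
      Finset.sum_le_card_nsmul _ _ _ fun d hd => by
        have hk := not_kiteCorner_of_mem_openCorners hd
        obtain ⟨rfl, -⟩ := mem_openCorners.1 hd
        rw [charge_of_needy ((hf d rfl).resolve_left hk) hv]
    by_cases hb : R.Bad v
    · have hs : R.share v = 0 := by
        unfold share
        rw [if_neg (not_not.2 hf), if_pos hb]
      rw [hs] at h3
      omega
    · have hs : R.share v = 2 := by
        unfold share
        rw [if_neg (not_not.2 hf), if_neg hb]
      have h4 : 1 < (R.openCorners v).card := by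
        rw [Finset.one_lt_card]
        by_contra hc
        push Not at hc
        have hm : ∀ d, d.fst = v → ¬ R.KiteCorner d → d ∈ R.openCorners v := by
          rintro d rfl hk
          have := ((hf d rfl).resolve_left hk).1
          exact mem_openCorners.2 ⟨rfl, this.1, this.free_rot_symm⟩
        exact hb ⟨hf, fun d e hd he hkd hke => hc d (hm d hd hkd) e (hm e he hke)⟩
      rw [hs] at h3
      omega
  · unfold Full at hf
    push Not at hf
    obtain ⟨d, rfl, hk, hn⟩ := hf
    have h0 := charge_eq_zero hn hk hv
    have h1 : ∀ e ∈ R.dartsAt d.fst, R.charge e ≤ 3 := by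
      intro e he
      rw [mem_dartsAt] at he
      by_cases hn : R.Needy e
      · rw [charge_of_needy hn (he ▸ hv)]
        exact share_le _
      · exact charge_le_three_of_not_needy hn
    have hd : d ∈ R.dartsAt d.fst := mem_dartsAt.2 rfl
    rw [← Finset.add_sum_erase _ _ hd, h0, zero_add]
    refine (Finset.sum_le_card_nsmul _ _ 3 fun e he => h1 e (Finset.mem_of_mem_erase he)).trans ?_
    rw [Finset.card_erase_of_mem hd, card_dartsAt, hv]
    norm_num

theorem sum_charge_le_of_degree_lt_ten
    (hno : ∀ a b c : V, G.Adj a b → G.Adj b c → G.Adj a c → G.degree a = 7 → G.degree b = 7 →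
      10 ≤ G.degree c) (hv : 8 ≤ G.degree v) (hv' : G.degree v < 10) :
    ∑ d ∈ R.dartsAt v, R.charge d + 24 ≤ 6 * G.degree v := by
  have h : ∑ d ∈ R.dartsAt v, R.charge d ≤ (R.dartsAt v).card * 3 :=
    Finset.sum_le_card_nsmul _ _ _ fun d hd => charge_le_three_of_not_needy fun hn => by
      rw [mem_dartsAt] at hd
      have := hn.degree_cases hno
      rw [hd] at this
      omega
  rw [card_dartsAt] at h
  omega

theorem Triangle.full_contradiction (hmin : ∀ v, 7 ≤ G.degree v)
    (hno : ∀ a b c : V, G.Adj a b → G.Adj b c → G.Adj a c → G.degree a = 7 → G.degree b = 7 →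
      10 ≤ G.degree c) {x : G.Dart} (hx : R.Triangle x) (hy : R.Triangle (R.rot x))
    (hg : G.degree x.snd = 7) (hfull : R.Full x.snd)
    (hbx : R.Bad (R.face (R.face x)).fst) (hby : R.Bad (R.face (R.rot x)).fst)
    (hdx : G.degree (R.face (R.face x)).fst = 7) (hdy : G.degree (R.face (R.rot x)).fst = 7) :
    False := by
  have hrs : ∀ d, R.rot.symm (R.rot d) = d := R.rot.symm_apply_apply
  set e0 := x.symm with he0
  have hf0 : ∀ d : G.Dart, d.fst = x.snd → R.KiteCorner d ∨ R.Needy d := hfull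
  have h0 : e0.fst = x.snd := rfl
  have hxe1 : R.face x = R.rot e0 := by
    rw [face_apply, show R.cross x = x.symm from hx.1]
  have hye0 : R.face (R.face (R.rot x)) = e0 := by
    have := hy.rot_symm
    rw [hrs] at this
    have h := congrArg SimpleGraph.Dart.symm this
    rw [dart_symm_symm] at h
    exact h.symm
  have ht1 : R.Triangle (R.rot e0) := hxe1 ▸ hx.face
  have ht0 : R.Triangle e0 := hye0 ▸ hy.face.face
  have hk2 : R.Kite (R.rot e0).symm := by
    refine Bad.kite_symm hmin ?_ ht1
    rw [← hxe1]
    exact hbx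
  have hf1 : R.Free (R.rot e0) := ht1.1
  have hn2 : ¬ R.Free (R.rot (R.rot e0)) := by
    rw [← face_symm_of_free hf1]
    exact hk2.2.1
  have hface0 : R.face e0 = R.rot x := by
    rw [← hye0, hy.2.2.2]
  have hk6 : R.Kite (R.rot.symm e0) := by
    refine Bad.kite_rot_symm hmin ?_ ht0
    rw [hface0]
    exact hby
  have hn5 : ¬ R.Free (R.rot.symm (R.rot.symm e0)) := hk6.not_free_rot_symm
  set e1 := R.rot e0 with he1
  set e2 := R.rot e1 with he2
  set e3 := R.rot e2 with he3
  set e4 := R.rot e3 with he4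
  set e5 := R.rot e4 with he5
  set e6 := R.rot e5 with he6
  have hpow : R.rot e6 = e0 := by
    have := R.rot_pow_degree hmin e0
    rw [h0, hg] at this
    exact this
  have q6 : R.rot.symm e0 = e6 := by rw [← hpow, hrs]
  have q5 : R.rot.symm e6 = e5 := hrs _
  rw [q6] at hk6 hn5
  rw [q5] at hn5
  have h3v : e3.fst = x.snd := by simp only [he3, he2, he1, R.rot_fst, h0]
  have h4v : e4.fst = x.snd := by rw [he4, R.rot_fst, h3v]
  have h5v : e5.fst = x.snd := by rw [he5, R.rot_fst, h4v]
  have p3 : R.rot.symm e3 = e2 := hrs _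
  have p4 : R.rot.symm e4 = e3 := hrs _
  have p5 : R.rot.symm e5 = e4 := hrs _
  have p2 : R.rot.symm e2 = e1 := hrs _
  have c3 : R.KiteCorner e3 := (hf0 e3 h3v).resolve_right fun h => hn2 (p3 ▸ h.1.free_rot_symm)
  have c5 : R.KiteCorner e5 := (hf0 e5 h5v).resolve_right fun h => hn5 h.1.1
  have f3 : R.Free e3 := c3.free_iff.2 (by rwa [p3])
  have f4 : R.Free e4 := by
    by_contra h
    exact hn5 (c5.free_iff.2 (by rwa [p5]))
  have c4 : R.Needy e4 := (hf0 e4 h4v).resolve_left fun h =>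
    h.free_iff.1 f4 (by rwa [p4])
  have k3 : R.Kite e3 := c3.kite f3
  have k5 : R.Kite e4.symm := by
    have := c5.kite_symm (by rwa [p5])
    rwa [p5] at this
  have a2 := adj_of_kite (R := R) (e := e2) (by rwa [p2]) k3
  have a5 := adj_of_kite (R := R) (e := e5) (by rwa [p5]) hk6
  rw [p2] at a2
  rw [p5] at a5
  have s1 : e1.snd = (R.face (R.face x)).fst := by
    rw [hxe1, R.face_fst_of_free hf1]
  have s6 : e6.snd = (R.face (R.rot x)).fst := by
    rw [← hface0, ← q6, ht0.rot_symm]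
    rfl
  have h1v : e1.fst = x.snd := by rw [he1, R.rot_fst, h0]
  have h6v : e6.fst = x.snd := by rw [he6, R.rot_fst, h5v]
  have d3 : 10 ≤ G.degree e3.snd :=
    hno x.snd e1.snd e3.snd (h1v ▸ e1.adj) a2 (h3v ▸ e3.adj) hg (by rw [s1, hdx])
  have d4 : 10 ≤ G.degree e4.snd :=
    hno x.snd e6.snd e4.snd (h6v ▸ e6.adj) a5.symm (h4v ▸ e4.adj) hg (by rw [s6, hdy])
  have z1 : (R.face e4).fst = e4.snd := R.face_fst_of_free f4
  have z2 : (R.face (R.face e4)).fst = e3.snd := by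
    have := c4.1.rot_symm
    rw [p4] at this
    rw [this]
    rfl
  have := c4.2
  rw [z1, z2, h4v] at this
  omega

end CrossingMap

end Vertices

section LargeVertex

variable {V : Type*} {G : SimpleGraph V} [Fintype V] [DecidableRel G.Adj]

namespace CrossingMap

variable {R : CrossingMap G} {d x : G.Dart} {v : V}

theorem two_le_share (h : ¬ R.Bad v) : 2 ≤ R.share v := by
  unfold share
  split_ifs <;> omega

theorem share_of_not_full (h : ¬ R.Full v) : R.share v = 3 := if_pos h

theorem charge_of_mem_openCorners (hd : d ∈ R.openCorners v) (hv : G.degree v ≠ 7) :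
    R.charge d = 0 ∨ R.Triangle d ∧ (R.charge d = 3 ∨ R.Needy d ∧
      R.charge d = 6 - R.share (R.face d).fst - R.share (R.face (R.face d)).fst) := by
  have hk := not_kiteCorner_of_mem_openCorners hd
  obtain ⟨rfl, -⟩ := mem_openCorners.1 hd
  by_cases ht : R.Triangle d
  · by_cases hn : R.Needy d
    · exact Or.inr ⟨ht, Or.inr ⟨hn, charge_of_needy' hn hv⟩⟩
    · exact Or.inr ⟨ht, Or.inl (charge_of_triangle ht hn hv)⟩
  · exact Or.inl (charge_of_not_triangle ht hk)

/-- Two consecutive open corners at a vertex of large degree. -/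
theorem charge_add_charge_rot_le (hmin : ∀ v, 7 ≤ G.degree v)
    (hno : ∀ a b c : V, G.Adj a b → G.Adj b c → G.Adj a c → G.degree a = 7 → G.degree b = 7 →
      10 ≤ G.degree c) (hv : G.degree v ≠ 7) (hx : x ∈ R.openCorners v)
    (hy : R.rot x ∈ R.openCorners v) : R.charge x + R.charge (R.rot x) ≤ 6 := by
  have hfx := (mem_openCorners.1 hx).2
  have hfy := (mem_openCorners.1 hy).2
  have hsx : R.Triangle x → (R.face x).fst = x.snd := fun h => R.face_fst_of_free h.1
  have hsy : R.Triangle (R.rot x) → (R.face (R.face (R.rot x))).fst = x.snd := fun h => by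
    have h1 := h.rot_symm
    rw [Equiv.symm_apply_apply] at h1
    exact (congrArg (fun d : G.Dart => d.snd) h1).symm
  have hbx : R.Triangle x → 2 ≤ R.share x.snd := fun h => two_le_share fun hb =>
    Bad.not_free_rot hmin (by rwa [hsx h]) h hfy.1
  have hby : R.Triangle (R.rot x) → 2 ≤ R.share x.snd := fun h => two_le_share fun hb => by
    have h1 := Bad.kite_rot_symm hmin (by rwa [hsy h]) h
    rw [Equiv.symm_apply_apply] at h1
    exact h1.not_free_rot_symm hfx.2
  have hcx := charge_of_mem_openCorners hx hv
  have hcy := charge_of_mem_openCorners hy hv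
  rcases hcx with hcx | ⟨htx, hcx⟩
  · rcases hcy with hcy | ⟨hty, hcy | ⟨-, hcy⟩⟩
    · omega
    · omega
    · rw [hsy hty] at hcy
      have := hby hty
      omega
  rcases hcy with hcy | ⟨hty, hcy⟩
  · rcases hcx with hcx | ⟨-, hcx⟩
    · omega
    · rw [hsx htx] at hcx
      have := hbx htx
      omega
  have hb := hbx htx
  by_cases hf : R.Full x.snd
  · have hnx : R.Needy x := needy_face_iff.1
      (Full.needy_of_triangle (by rwa [hsx htx]) htx.face)
    have hny : R.Needy (R.rot x) := needy_face_iff.1 (needy_face_iff.1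
      (Full.needy_of_triangle (by rwa [hsy hty]) hty.face.face))
    have hvx := (mem_openCorners.1 hx).1
    have hvy := (mem_openCorners.1 hy).1
    have ex : G.degree (R.face x).fst = 7 ∧ G.degree (R.face (R.face x)).fst = 7 := by
      have := hnx.2
      rw [hvx] at this
      tauto
    have ey : G.degree (R.face (R.rot x)).fst = 7 := by
      have := hny.2
      rw [hvy] at this
      tauto
    replace hcx := charge_of_needy' hnx (hvx ▸ hv)
    replace hcy := charge_of_needy' hny (hvy ▸ hv)
    rw [hsx htx] at ex hcx
    rw [hsy hty] at hcy
    by_cases b1 : R.Bad (R.face (R.face x)).fst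
    · by_cases b2 : R.Bad (R.face (R.rot x)).fst
      · exact (htx.full_contradiction hmin hno hty ex.1 hf b1 b2 ex.2 ey).elim
      · have := two_le_share b2
        omega
    · have := two_le_share b1
      omega
  · rw [hsx htx] at hcx
    rw [hsy hty] at hcy
    have := share_of_not_full hf
    omega

theorem sum_charge_le_of_ten_le_degree (hmin : ∀ v, 7 ≤ G.degree v)
    (hno : ∀ a b c : V, G.Adj a b → G.Adj b c → G.Adj a c → G.degree a = 7 → G.degree b = 7 →
      10 ≤ G.degree c) (hv : 10 ≤ G.degree v) :
    ∑ d ∈ R.dartsAt v, R.charge d + 24 ≤ 6 * G.degree v := by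
  classical
  obtain ⟨h1, h2⟩ := R.sum_charge_le v
  have hv7 : G.degree v ≠ 7 := by omega
  have h6 : ∀ d ∈ R.openCorners v, R.charge d ≤ 6 := fun d hd => by
    rcases charge_of_mem_openCorners hd hv7 with h | ⟨-, h | ⟨-, h⟩⟩ <;> omega
  set A := (R.openCorners v).filter fun d => R.Triangle d ∧ R.Bad (R.face d).fst with hA
  set B := (R.openCorners v).filter fun d => R.Triangle d ∧ R.Bad (R.face (R.face d)).fst with hB
  have hAc : A.card ≤ (R.entries v).card := by
    rw [← card_exits]
    refine Finset.card_le_card fun d hd => ?_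
    simp only [hA, Finset.mem_filter, mem_openCorners] at hd
    exact mem_exits.2 ⟨hd.1.1, hd.1.2.1, Bad.not_free_rot hmin hd.2.2 hd.2.1⟩
  have hBc : B.card ≤ (R.entries v).card := by
    refine Finset.card_le_card_of_injOn R.rot.symm (fun d hd => ?_) R.rot.symm.injective.injOn
    simp only [hB, Finset.coe_filter, Set.mem_ofPred_eq, mem_openCorners] at hd
    exact mem_entries.2 ⟨(R.rot_symm_fst d).trans hd.1.1, hd.1.2.2,
      (Bad.kite_rot_symm hmin hd.2.2 hd.2.1).not_free_rot_symm⟩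
  have hAB : (A ∪ B).card ≤ (R.openCorners v).card :=
    Finset.card_le_card (Finset.union_subset (Finset.filter_subset _ _) (Finset.filter_subset _ _))
  have hie := Finset.card_union_add_card_inter A B
  have hsum : ∑ d ∈ R.openCorners v, R.charge d ≤
      3 * (R.openCorners v).card + A.card + B.card + (A ∩ B).card := by
    have hA' : A.card = ∑ d ∈ R.openCorners v,
        if R.Triangle d ∧ R.Bad (R.face d).fst then 1 else 0 := Finset.card_filter _ _
    have hB' : B.card = ∑ d ∈ R.openCorners v,
        if R.Triangle d ∧ R.Bad (R.face (R.face d)).fst then 1 else 0 := Finset.card_filter _ _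
    have hAB' : (A ∩ B).card = ∑ d ∈ R.openCorners v,
        if (R.Triangle d ∧ R.Bad (R.face d).fst) ∧
          (R.Triangle d ∧ R.Bad (R.face (R.face d)).fst) then 1 else 0 := by
      rw [hA, hB, ← Finset.filter_and, Finset.card_filter]
    rw [hA', hB', hAB', mul_comm, ← smul_eq_mul, ← Finset.sum_const, ← Finset.sum_add_distrib,
      ← Finset.sum_add_distrib, ← Finset.sum_add_distrib]
    refine Finset.sum_le_sum fun d hd => ?_
    rcases charge_of_mem_openCorners hd hv7 with h | ⟨-, h | ⟨hn, h⟩⟩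
    · omega
    · omega
    · have ht := hn.1
      by_cases b1 : R.Bad (R.face d).fst
      · by_cases b2 : R.Bad (R.face (R.face d)).fst
        · simp only [ht, b1, b2, and_self, if_true]
          omega
        · have := two_le_share b2
          simp only [ht, b1, b2, and_self, and_false, if_true, if_false]
          omega
      · have := two_le_share b1
        by_cases b2 : R.Bad (R.face (R.face d)).fst
        · simp only [ht, b1, b2, and_self, and_false, false_and, if_true, if_false]
          omega
        · have := two_le_share b2
          omega
  have hiA : (A ∩ B).card ≤ A.card := Finset.card_le_card Finset.inter_subset_left
  have hiB : (A ∩ B).card ≤ B.card := Finset.card_le_card Finset.inter_subset_right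
  by_cases hex : G.degree v = 10 ∧ (R.entries v).card = 3 ∧ (R.openCorners v).card = 4
  · obtain ⟨e1, e2, e3⟩ := hex
    obtain ⟨x, hx, hxe⟩ : ∃ x ∈ R.openCorners v, x ∉ R.exits v := by
      by_contra! hc
      have := Finset.card_le_card hc
      rw [card_exits] at this
      omega
    obtain ⟨g1, g2, g3⟩ := mem_openCorners.1 hx
    have hy : R.rot x ∈ R.openCorners v := by
      refine mem_openCorners.2 ⟨(R.rot_fst x).trans g1, ?_, by rwa [Equiv.symm_apply_apply]⟩
      by_contra hc
      exact hxe (mem_exits.2 ⟨g1, g2, hc⟩)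
    have hs := charge_add_charge_rot_le hmin hno hv7 hx hy
    have hy' : R.rot x ∈ (R.openCorners v).erase x :=
      Finset.mem_erase.2 ⟨R.rot_ne_self hmin x, hy⟩
    have hr : ∑ d ∈ ((R.openCorners v).erase x).erase (R.rot x), R.charge d ≤
        (((R.openCorners v).erase x).erase (R.rot x)).card * 6 :=
      Finset.sum_le_card_nsmul _ _ _ fun d hd =>
        h6 d (Finset.mem_of_mem_erase (Finset.mem_of_mem_erase hd))
    rw [Finset.card_erase_of_mem hy', Finset.card_erase_of_mem hx] at hr
    rw [← Finset.add_sum_erase _ _ hx, ← Finset.add_sum_erase _ _ hy'] at h2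
    omega
  · omega

theorem sum_charge_le_degree (hmin : ∀ v, 7 ≤ G.degree v)
    (hno : ∀ a b c : V, G.Adj a b → G.Adj b c → G.Adj a c → G.degree a = 7 → G.degree b = 7 →
      10 ≤ G.degree c) (R : CrossingMap G) (v : V) :
    ∑ d ∈ R.dartsAt v, R.charge d + 24 ≤ 6 * G.degree v := by
  rcases (hmin v).eq_or_lt with h | h
  · have := sum_charge_le_of_degree_seven (R := R) h.symm
    omega
  · rcases lt_or_ge (G.degree v) 10 with h' | h'
    · exact sum_charge_le_of_degree_lt_ten hno h h'
    · exact sum_charge_le_of_ten_le_degree hmin hno h'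

theorem sum_charge_add_le (hmin : ∀ v, 7 ≤ G.degree v)
    (hno : ∀ a b c : V, G.Adj a b → G.Adj b c → G.Adj a c → G.degree a = 7 → G.degree b = 7 →
      10 ≤ G.degree c) (R : CrossingMap G) :
    ∑ d, R.charge d + 24 * Fintype.card V ≤ 6 * Fintype.card G.Dart := by
  classical
  have h : ∑ v, (∑ d ∈ R.dartsAt v, R.charge d + 24) ≤ ∑ v, 6 * G.degree v :=
    Finset.sum_le_sum fun v _ => R.sum_charge_le_degree hmin hno v
  rw [Finset.sum_add_distrib, ← Finset.mul_sum, ← G.dart_card_eq_sum_degrees, Finset.sum_const,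
    Finset.card_univ, smul_eq_mul] at h
  rw [← Finset.sum_fiberwise Finset.univ fun d : G.Dart => d.fst]
  convert h using 2
  · refine Finset.sum_congr rfl fun v _ => Finset.sum_congr ?_ fun _ _ => rfl
    ext d
    simp [mem_dartsAt]
  · exact mul_comm _ _

end CrossingMap

end LargeVertex

end OnePlanar

/-- Every 1-planar graph with minimum degree 7 contains a triangle of type
(7, 7, 9⁻). -/
theorem one_planar_light_triangle {V : Type*} [Fintype V] [Nonempty V]
    (G : SimpleGraph V) [DecidableRel G.Adj] (h1p : G.IsOnePlanar)
    (hmin : ∀ v : V, 7 ≤ G.degree v) :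
    ∃ a b c : V, G.Adj a b ∧ G.Adj b c ∧ G.Adj a c ∧
      G.degree a = 7 ∧ G.degree b = 7 ∧ G.degree c ≤ 9 := by
  obtain ⟨R, hP, hR⟩ := OnePlanar.exists_planar_noAdjacentCrossing h1p
  by_contra! hc
  have hno : ∀ a b c : V, G.Adj a b → G.Adj b c → G.Adj a c → G.degree a = 7 → G.degree b = 7 →
      10 ≤ G.degree c := hc
  have h1 := R.euler_count hP hR hmin
  have h2 := OnePlanar.CrossingMap.sum_charge_ge hno R
  have h3 := R.sum_charge_add_le hmin hno
  omega
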